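/- Let r ≥ 1 and let f(x,y) ∈ ℚ[x,y] be an irreducible homogeneous polynomial (binary form) of degree d with d > r and d ≥ 2, and let b be a nonzero integer. Then the set of tuples (n₁, …, n_r) of natural numbers for which b·n₁‼ ⋯ n_r‼ is represented by f, i.e. for which there exist integers x, y with f(x,y) = b·n₁‼ ⋯ n_r‼, is finite. -/

import Mathlib

theorem preconn_frontier {α : Type*} [TopologicalSpace α] {s t : Set α} (ht : IsPreconnected t)
    (h1 : (t ∩ s).Nonempty) (h2 : (t ∩ sᶜ).Nonempty) : (t ∩ frontier s).Nonempty := by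
  by_contra h
  rw [Set.not_nonempty_iff_eq_empty] at h
  have hcov : ∀ x ∈ t, x ∈ interior s ∨ x ∈ interior sᶜ := by
    intro x hx
    by_contra hc
    push Not at hc
    have : x ∈ t ∩ frontier s := by
      refine ⟨hx, ?_, hc.1⟩
      by_contra h3
      exact hc.2 (by rw [interior_compl]; exact h3)
    rw [h] at this
    exact this
  obtain ⟨x, hx, hxs⟩ := h1
  obtain ⟨y, hy, hys⟩ := h2
  have hx' : x ∈ interior s := by
    rcases hcov x hx with h | h
    · exact h
    · exact absurd hxs (interior_subset h)
  have hy' : y ∈ interior sᶜ := by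
    rcases hcov y hy with h | h
    · exact absurd (interior_subset h) hys
    · exact h
  obtain ⟨z, -, hz1, hz2⟩ := ht _ _ isOpen_interior isOpen_interior hcov ⟨x, hx, hx'⟩ ⟨y, hy, hy'⟩
  exact interior_subset hz2 (interior_subset hz1)

open MeasureTheory Metric Set Bornology in
theorem card_lattice_bound {E : Type*} [NormedAddCommGroup E] [NormedSpace ℝ E]
    [FiniteDimensional ℝ E] [MeasurableSpace E] [BorelSpace E] (μ : Measure E)
    [μ.IsAddHaarMeasure] (L : Submodule ℤ E) [DiscreteTopology L] [IsZLattice ℝ L] :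
    ∃ D : ℝ, 0 < D ∧ ∀ S : Set E, MeasurableSet S → IsBounded S →
      |(Nat.card ↑(S ∩ (L : Set E)) : ℝ) * ZLattice.covolume L μ - μ.real S|
        ≤ μ.real (cthickening D (frontier S)) := by
  classical
  let b := Module.Free.chooseBasis ℤ L
  let B := b.ofZLatticeBasis ℝ L
  let F := ZSpan.fundamentalDomain B
  have hFb : IsBounded F := ZSpan.fundamentalDomain_isBounded B
  obtain ⟨R, hR0, hR⟩ := hFb.exists_pos_norm_le
  have hfund : IsAddFundamentalDomain L F μ := ZLattice.isAddFundamentalDomain b μ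
  have hcov : ZLattice.covolume L μ = μ.real F :=
    ZLattice.covolume_eq_measure_fundamentalDomain L μ hfund
  refine ⟨R, hR0, fun S hSm hSb => ?_⟩
  set T := cthickening R (frontier S) with hT
  have hTb : IsBounded T := (hSb.closure.subset frontier_subset_closure).cthickening
  have hTfin : μ T ≠ ⊤ := hTb.measure_lt_top.ne
  have hSfin : μ S ≠ ⊤ := hSb.measure_lt_top.ne
  have hfin : (S ∩ (L : Set E)).Finite := by
    have := ZSpan.setFinite_inter B hSb
    rwa [b.ofZLatticeBasis_span ℝ L] at this
  have key : ∀ v x : E, dist x v ≤ R → (v ∈ S ↔ ¬ x ∈ S) → x ∈ T := by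
    intro v x hd hiff
    have hpre : IsPreconnected (segment ℝ v x) := (convex_segment v x).isPreconnected
    have : (segment ℝ v x ∩ frontier S).Nonempty := by
      by_cases hv : v ∈ S
      · exact preconn_frontier hpre ⟨v, left_mem_segment ℝ v x, hv⟩
          ⟨x, right_mem_segment ℝ v x, hiff.1 hv⟩
      · exact preconn_frontier hpre
          ⟨x, right_mem_segment ℝ v x, by tauto⟩ ⟨v, left_mem_segment ℝ v x, hv⟩
    obtain ⟨z, hz, hzf⟩ := this
    refine mem_cthickening_of_dist_le x z R _ hzf ?_
    have := dist_add_dist_of_mem_segment hz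
    have h2 := dist_nonneg (x := v) (y := z)
    rw [dist_comm x z]
    rw [dist_comm x v] at hd
    linarith
  let U : Set E := ⋃ v ∈ hfin.toFinset, (fun x => v + x) '' F
  have hFm : MeasurableSet F := ZSpan.fundamentalDomain_measurableSet B
  have hUmeas : μ U = (hfin.toFinset.card : ENNReal) * μ F := by
    rw [measure_biUnion_finset]
    · simp only [image_add_left, measure_preimage_add, Finset.sum_const, nsmul_eq_mul]
    · intro v hv w hw hvw
      simp only [Finset.mem_coe, Set.Finite.mem_toFinset] at hv hw
      refine Set.disjoint_left.2 ?_
      rintro _ ⟨x, hx, rfl⟩ ⟨y, hy, hxy⟩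
      apply hvw
      have h1 : x - y ∈ L := by
        have : x - y = w - v := by
          have := hxy
          simp only at this
          rw [sub_eq_sub_iff_add_eq_add, add_comm x v, ← this]
        rw [this]; exact L.sub_mem hw.2 hv.2
      have h2 : x = y := by
        have hs := b.ofZLatticeBasis_span ℝ L
        rw [← hs] at h1
        have := (ZSpan.fract_eq_fract B x y).2 (by
          have := neg_mem h1
          simpa [sub_eq_neg_add, add_comm] using this)
        rwa [ZSpan.fract_eq_self.2 hx, ZSpan.fract_eq_self.2 hy] at this
      subst h2
      exact (add_right_cancel hxy).symm
    · intro v hv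
      rw [image_add_left]
      exact hFm.preimage (measurable_const_add _)
  have hUS : U ⊆ S ∪ T := by
    intro x hx
    simp only [U, Set.mem_iUnion, Set.Finite.mem_toFinset] at hx
    obtain ⟨v, hv, y, hy, rfl⟩ := hx
    by_cases h : v + y ∈ S
    · exact Or.inl h
    · exact Or.inr (key v _ (by simpa using hR y hy) (by simp [hv.1, h]))
  have hSU : S ⊆ U ∪ T := by
    intro x hx
    set v : E := ((ZSpan.floor B x : _) : E) with hvdef
    have hvL : v ∈ L := by
      have := (ZSpan.floor B x).2
      exact (b.ofZLatticeBasis_span ℝ L).le this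
    have hxv : x = v + ZSpan.fract B x := by rw [ZSpan.fract_apply]; abel
    have hfr : ZSpan.fract B x ∈ F := ZSpan.fract_mem_fundamentalDomain B x
    by_cases h : v ∈ S
    · left
      simp only [U, Set.mem_iUnion, Set.Finite.mem_toFinset]
      exact ⟨v, ⟨h, hvL⟩, _, hfr, hxv.symm⟩
    · right
      refine key v x ?_ (by simp [h, hx])
      have : x - v = ZSpan.fract B x := by rw [sub_eq_iff_eq_add']; exact hxv
      rw [dist_eq_norm, this]; exact hR _ hfr
  have hFfin : μ F ≠ ⊤ := hFb.measure_lt_top.ne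
  have hUfin : μ U ≠ ⊤ := by rw [hUmeas]; exact ENNReal.mul_ne_top (by simp) hFfin
  have hUreal : μ.real U = (Nat.card ↑(S ∩ (L : Set E)) : ℝ) * ZLattice.covolume L μ := by
    rw [hcov, measureReal_def, hUmeas, ENNReal.toReal_mul, Nat.card_coe_set_eq,
      Set.ncard_eq_toFinset_card _ hfin]; rfl
  rw [← hUreal]
  have e1 : μ.real U ≤ μ.real S + μ.real T :=
    (measureReal_mono hUS (measure_union_ne_top hSfin hTfin)).trans (measureReal_union_le _ _)
  have e2 : μ.real S ≤ μ.real U + μ.real T :=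
    (measureReal_mono hSU (measure_union_ne_top hUfin hTfin)).trans (measureReal_union_le _ _)
  rw [abs_le]; constructor <;> linarith

open MeasureTheory Metric Set in
theorem face_thickening {ι : Type*} [Fintype ι] [DecidableEq ι]
    {E : Type*} [NormedAddCommGroup E] [NormedSpace ℝ E]
    [FiniteDimensional ℝ E] [MeasurableSpace E] [BorelSpace E] (μ : Measure E)
    [μ.IsAddHaarMeasure] (hE : Module.finrank ℝ E = Fintype.card ι) (f : (ι → ℝ) → E)
    (Kf : NNReal) (hf : LipschitzOnWith Kf f (Icc 0 1)) (w : ι) (b : ℝ) (hb : b ∈ Icc (0:ℝ) 1) :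
    ∃ C : ℝ, 0 ≤ C ∧ ∀ ε : ℝ, 0 < ε → ε ≤ 1 →
      μ.real (cthickening ε (f '' {y | y ∈ Icc (0 : ι → ℝ) 1 ∧ y w = b})) ≤ C * ε := by
  classical
  set n := Fintype.card ι with hn
  have hnpos : 0 < n := Fintype.card_pos_iff.2 ⟨w⟩
  set c := μ.real (ball (0:E) 1)
  refine ⟨3 ^ (n-1) * ((Kf + 2) ^ n * c), by positivity, fun ε hε hε1 => ?_⟩
  set N := ⌈1/ε⌉₊ with hN
  have hNle : 1/ε ≤ N := Nat.le_ceil _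
  have hNpos : (0:ℝ) < N := lt_of_lt_of_le (by positivity) hNle
  have hN1 : (N:ℝ) + 1 ≤ 3/ε := by
    have h1 : (N:ℝ) < 1/ε + 1 := Nat.ceil_lt_add_one (by positivity)
    have h2 : 1 ≤ 1/ε := by rw [le_div_iff₀ hε]; linarith
    have : 3/ε = 1/ε+1/ε+1/ε := by ring
    linarith
  have hinv : 1/(N:ℝ) ≤ ε := by
    rw [div_le_iff₀ hNpos]; rw [div_le_iff₀ hε] at hNle; linarith
  let pt : ({i // i ≠ w} → Fin (N+1)) → ι → ℝ := fun g i =>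
    if h : i = w then b else ((g ⟨i, h⟩ : ℕ) : ℝ) / N
  have hpt : ∀ g, pt g ∈ Icc (0 : ι → ℝ) 1 := by
    intro g
    constructor <;> intro i <;> simp only [pt, Pi.zero_apply, Pi.one_apply] <;> split_ifs with h
    · exact hb.1
    · positivity
    · exact hb.2
    · rw [div_le_one hNpos]
      exact_mod_cast Nat.lt_succ_iff.1 (g ⟨i, h⟩).2
  have hcover : cthickening ε (f '' {y | y ∈ Icc (0 : ι → ℝ) 1 ∧ y w = b}) ⊆
      ⋃ g ∈ (Finset.univ : Finset ({i // i ≠ w} → Fin (N+1))),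
        closedBall (f (pt g)) ((Kf + 2) * ε) := by
    intro x hx
    have hx2 := cthickening_subset_thickening' (by positivity : 0 < 2*ε) (by linarith : ε < 2*ε) _ hx
    rw [mem_thickening_iff] at hx2
    obtain ⟨_, ⟨y, ⟨hy, hyw⟩, rfl⟩, hd⟩ := hx2
    let g : {i // i ≠ w} → Fin (N+1) := fun i => ⟨⌊y i * N⌋₊, by
      rw [Nat.lt_succ_iff]
      refine Nat.floor_le_of_le ?_
      have := hy.2 i.1
      simp only [Pi.one_apply] at this
      nlinarith⟩
    simp only [Finset.mem_univ, iUnion_true, mem_iUnion, mem_closedBall]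
    refine ⟨g, ?_⟩
    have hyg : dist y (pt g) ≤ ε := by
      rw [dist_pi_le_iff hε.le]
      intro i
      simp only [pt, g]
      split_ifs with h
      · subst h; rw [hyw]; simpa using hε.le
      · refine le_trans ?_ hinv
        have h0 : 0 ≤ y i * N := mul_nonneg (hy.1 i) hNpos.le
        have h1 := Nat.floor_le h0
        have h2 := Nat.lt_floor_add_one (y i * N)
        have : y i - (⌊y i * N⌋₊ : ℝ) / N = (y i * N - ⌊y i * N⌋₊) / N := by
          field_simp
        rw [Real.dist_eq, this, abs_of_nonneg (div_nonneg (by linarith) hNpos.le)]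
        gcongr; linarith
    have h3 := hf.dist_le_mul y hy _ (hpt g)
    calc dist x (f (pt g)) ≤ dist x (f y) + dist (f y) (f (pt g)) := dist_triangle _ _ _
      _ ≤ 2 * ε + Kf * ε := by
        refine add_le_add hd.le (h3.trans ?_)
        gcongr
      _ = _ := by ring
  calc _ ≤ μ.real (⋃ g ∈ (Finset.univ : Finset ({i // i ≠ w} → Fin (N+1))),
        closedBall (f (pt g)) ((Kf + 2) * ε)) := by
        refine measureReal_mono hcover ?_
        refine (measure_biUnion_lt_top (Finset.finite_toSet _) fun g _ => ?_).ne
        exact measure_closedBall_lt_top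
    _ ≤ ∑ g : ({i // i ≠ w} → Fin (N+1)), μ.real (closedBall (f (pt g)) ((Kf + 2) * ε)) :=
        measureReal_biUnion_finset_le _ _
    _ = ((N:ℝ)+1)^(n-1) * (((Kf+2)*ε)^n * c) := by
        simp_rw [Measure.addHaar_real_closedBall μ _ (by positivity : 0 ≤ ((Kf:ℝ) + 2) * ε), hE]
        rw [Finset.sum_const, nsmul_eq_mul]
        simp [Fintype.card_subtype_compl, hn]
        exact Or.inl (Or.inl rfl)
    _ ≤ (3/ε)^(n-1) * (((Kf+2)*ε)^n * c) := by gcongr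
    _ = _ := by
        obtain ⟨m, hm⟩ : ∃ m, n = m + 1 := ⟨n - 1, by omega⟩
        rw [hm]
        simp only [Nat.add_sub_cancel]
        rw [div_pow, mul_pow, pow_succ ε]
        field_simp

section P2b
open MeasureTheory Metric Set NumberField NumberField.InfinitePlace NumberField.mixedEmbedding
  NumberField.mixedEmbedding.fundamentalCone NumberField.Units NumberField.Units.dirichletUnitTheorem

open scoped Classical in
theorem bdParam_lipschitz (K : Type*) [Field K] [NumberField K] :
    ∃ Kf : NNReal, LipschitzOnWith Kf (fun y : realSpace K => (y w₀) •
      (expMapBasis (fun i => if i = w₀ then 0 else y i) : realSpace K)) (Icc 0 1) := by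
  have hcd : ContDiff ℝ 1 (fun y : realSpace K => (y w₀) •
      (expMapBasis (fun i => if i = w₀ then 0 else y i) : realSpace K)) := by
    have h1 : ContDiff ℝ 1 (fun y : realSpace K => (fun i => if i = w₀ then 0 else y i :
        realSpace K)) := by
      rw [contDiff_pi]
      intro i
      split_ifs
      · exact contDiff_const
      · fun_prop
    have h2 : ContDiff ℝ 1 (fun y : realSpace K => (expMapBasis y : realSpace K)) := by
      rw [contDiff_pi]
      intro w
      simp_rw [expMapBasis_apply, expMap_apply]
      refine Real.contDiff_exp.comp (contDiff_const.mul ?_)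
      exact (contDiff_apply ℝ ℝ w).comp (completeBasis K).equivFunL.symm.contDiff
    exact (contDiff_apply ℝ ℝ _).smul (h2.comp h1)
  have := (hcd.locallyLipschitz).locallyLipschitzOn (s := Icc 0 1)
  exact this.exists_lipschitzOnWith_of_compact isCompact_Icc

open scoped Classical in
theorem bd_cover (K : Type*) [Field K] [NumberField K] :
    compactSet K \ expMapBasis '' interior (paramSet K) ⊆
      ⋃ w : InfinitePlace K, ⋃ b ∈ ({0, 1} : Finset ℝ),
       (fun y : realSpace K => (y w₀) •
      (expMapBasis (fun i => if i = w₀ then 0 else y i) : realSpace K)) ''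
        {y | y ∈ Icc (0 : realSpace K) 1 ∧ y w = b} := by
  rintro x ⟨⟨c, hc, ⟨_, ⟨y, hy, rfl⟩, rfl⟩⟩, hx⟩
  have hy0 : y w₀ = 0 := by simpa using hy w₀ (mem_univ _)
  have hy1 : ∀ i, i ≠ w₀ → y i ∈ Icc (0:ℝ) 1 := fun i hi => by
    simpa [hi] using hy i (mem_univ _)
  set z : realSpace K := fun i => if i = w₀ then c else y i with hz
  have hzy : (fun i => if i = w₀ then 0 else z i) = y := by
    ext i
    by_cases hi : i = w₀ <;> simp [hi, hz, hy0]
  have hzI : z ∈ Icc (0 : realSpace K) 1 := by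
    constructor <;> intro i <;> by_cases hi : i = w₀ <;> simp [hi, hz, hc.1, hc.2, (hy1 i _).1,
      (hy1 i _).2]
  have hzw : z w₀ = c := by simp [hz]
  by_cases hface : ∃ w, z w = 0 ∨ z w = 1
  · obtain ⟨w, hw⟩ := hface
    simp only [mem_iUnion]
    refine ⟨w, z w, by simpa using hw, z, ⟨hzI, rfl⟩, ?_⟩
    simp only [hzw, hzy]
  · exfalso
    push Not at hface
    apply hx
    have hlt : ∀ w, 0 < z w ∧ z w < 1 := fun w =>
      ⟨lt_of_le_of_ne (hzI.1 w) (hface w).1.symm, lt_of_le_of_ne (hzI.2 w) (hface w).2⟩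
    refine ⟨fun w => if w = w₀ then Real.log c else y w, ?_, ?_⟩
    · rw [interior_paramSet, mem_univ_pi]
      intro w
      have := hlt w
      by_cases hw : w = w₀
      · subst hw
        rw [hzw] at this
        simpa using Real.log_neg this.1 this.2
      · simpa [hw, hz] using this
    · have := (hlt w₀).1
      rw [hzw] at this
      rw [expMapBasis_apply'', if_pos rfl, Real.exp_log this]
      simp only
      congr 2
      ext i
      by_cases hi : i = w₀ <;> simp [hi, hy0]

theorem bd_thickening (K : Type*) [Field K] [NumberField K] :
    ∃ C : ℝ, 0 ≤ C ∧ ∀ ε : ℝ, 0 < ε → ε ≤ 1 →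
      volume.real (cthickening ε (compactSet K \ expMapBasis '' interior (paramSet K))) ≤ C * ε := by
  classical
  obtain ⟨Kf, hKf⟩ := bdParam_lipschitz K
  have key : ∀ (w : InfinitePlace K) (b : ℝ), ∃ C : ℝ, 0 ≤ C ∧ (b ∈ ({0, 1} : Finset ℝ) →
      ∀ ε : ℝ, 0 < ε → ε ≤ 1 → volume.real (cthickening ε ((fun y : realSpace K => (y w₀) •
      (expMapBasis (fun i => if i = w₀ then 0 else y i) : realSpace K)) ''
        {y | y ∈ Icc (0 : realSpace K) 1 ∧ y w = b})) ≤ C * ε) := by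
    intro w b
    by_cases hb : b ∈ ({0, 1} : Finset ℝ)
    · obtain ⟨C, hC, h⟩ := face_thickening (ι := InfinitePlace K) (E := realSpace K) volume
        (Module.finrank_fintype_fun_eq_card _) _ Kf hKf w b (by
          simp at hb; rcases hb with rfl | rfl <;> simp)
      exact ⟨C, hC, fun _ => h⟩
    · exact ⟨0, le_rfl, fun h => absurd h hb⟩
  choose C hC0 hC using key
  refine ⟨∑ w : InfinitePlace K, ∑ b ∈ ({0, 1} : Finset ℝ), C w b, Finset.sum_nonneg fun w _ => Finset.sum_nonneg fun b _ => hC0 w b,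
    fun ε hε hε1 => ?_⟩
  have hbdd : ∀ w b, Bornology.IsBounded ((fun y : realSpace K => (y w₀) •
      (expMapBasis (fun i => if i = w₀ then 0 else y i) : realSpace K)) ''
        {y | y ∈ Icc (0 : realSpace K) 1 ∧ y w = b}) := fun w b =>
    (isCompact_Icc.image_of_continuousOn hKf.continuousOn).isBounded.subset
      (image_mono fun y hy => hy.1)
  have hsub := cthickening_subset_of_subset ε (bd_cover K)
  have hun : cthickening ε (⋃ w : InfinitePlace K, ⋃ b ∈ ({0, 1} : Finset ℝ),
       (fun y : realSpace K => (y w₀) •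
      (expMapBasis (fun i => if i = w₀ then 0 else y i) : realSpace K)) ''
        {y | y ∈ Icc (0 : realSpace K) 1 ∧ y w = b}) ⊆
      ⋃ w ∈ (Finset.univ : Finset (InfinitePlace K)), ⋃ b ∈ ({0, 1} : Finset ℝ),
      cthickening ε ((fun y : realSpace K => (y w₀) •
      (expMapBasis (fun i => if i = w₀ then 0 else y i) : realSpace K)) ''
        {y | y ∈ Icc (0 : realSpace K) 1 ∧ y w = b}) := by
    intro x hx
    rw [mem_cthickening_iff] at hx
    simp only [infEDist_iUnion] at hx
    by_contra hcon
    simp only [mem_iUnion, not_exists, mem_cthickening_iff, not_le] at hcon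
    refine absurd hx (not_le.2 ?_)
    rw [← Finset.inf_univ_eq_iInf, Finset.lt_inf_iff (by simp)]
    intro w _
    rw [← Finset.inf_eq_iInf, Finset.lt_inf_iff (by simp)]
    intro b hb
    exact hcon w (Finset.mem_univ _) b hb
  have hfin : ∀ w b, volume (cthickening ε ((fun y : realSpace K => (y w₀) •
      (expMapBasis (fun i => if i = w₀ then 0 else y i) : realSpace K)) ''
        {y | y ∈ Icc (0 : realSpace K) 1 ∧ y w = b})) < ⊤ := fun w b =>
    (hbdd w b).cthickening.measure_lt_top
  refine (measureReal_mono (hsub.trans hun) ?_).trans ?_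
  · refine (measure_biUnion_lt_top (Finset.finite_toSet _) fun w _ => ?_).ne
    exact measure_biUnion_lt_top (Finset.finite_toSet _) fun b _ => hfin w b
  · refine (measureReal_biUnion_finset_le _ _).trans ?_
    rw [Finset.sum_mul]
    refine Finset.sum_le_sum fun w _ => ?_
    refine (measureReal_biUnion_finset_le _ _).trans ?_
    rw [Finset.sum_mul]
    exact Finset.sum_le_sum fun b hb => hC w b hb ε hε hε1

open scoped Classical in
theorem normAtAllPlaces_dist_le {K : Type*} [Field K] [NumberField K] (x y : mixedSpace K) :
    dist (normAtAllPlaces x) (normAtAllPlaces y) ≤ dist x y := by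
  rw [dist_pi_le_iff dist_nonneg]
  intro w
  rw [Real.dist_eq, normAtAllPlaces_apply, normAtAllPlaces_apply, dist_eq_norm]
  have h : ∀ z : mixedSpace K, normAtPlace w z ≤ ‖z‖ := fun z => by
    rw [norm_eq_sup'_normAtPlace]
    exact Finset.le_sup' (fun w => normAtPlace w z) (Finset.mem_univ w)
  rw [abs_le]
  have h1 := normAtPlace_add_le w (x - y) y
  have h2 := normAtPlace_add_le w (y - x) x
  simp only [sub_add_cancel] at h1 h2
  have h3 := h (x - y)
  have h4 := h (y - x)
  rw [norm_sub_rev] at h4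
  constructor <;> linarith

open scoped Classical in
theorem frontier_normLeOne_thickening (K : Type*) [Field K] [NumberField K] :
    ∃ C : ℝ, 0 ≤ C ∧ ∀ ε : ℝ, 0 < ε → ε ≤ 1/2 →
      volume.real (cthickening ε (frontier (normLeOne K))) ≤ C * ε := by
  obtain ⟨C, hC0, hC⟩ := bd_thickening K
  set Bd := compactSet K \ expMapBasis '' interior (paramSet K) with hBd
  have hBdb : Bornology.IsBounded Bd := (isCompact_compactSet K).isBounded.subset sdiff_subset
  obtain ⟨M, hM0, hM⟩ := (hBdb.cthickening (δ := 1)).exists_pos_norm_le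
  have hfr : frontier (normLeOne K) ⊆ normAtAllPlaces ⁻¹' Bd := by
    intro x hx
    exact ⟨closure_normLeOne_subset K hx.1, fun h => hx.2 (subset_interior_normLeOne K h)⟩
  set k := Fintype.card {w : InfinitePlace K // IsComplex w}
  refine ⟨2 ^ nrRealPlaces K * (2 * Real.pi) ^ nrComplexPlaces K * M ^ k * (C * 2),
    by positivity, fun ε hε hε1 => ?_⟩
  set A : Set (mixedSpace K) := normAtAllPlaces ⁻¹' (cthickening (2*ε) Bd) with hA
  have hsub : cthickening ε (frontier (normLeOne K)) ⊆ A := by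
    intro x hx
    have hx2 := cthickening_subset_thickening' (by positivity : 0 < 2*ε) (by linarith : ε < 2*ε) _ hx
    rw [mem_thickening_iff] at hx2
    obtain ⟨z, hz, hd⟩ := hx2
    refine thickening_subset_cthickening _ _ ?_
    rw [mem_thickening_iff]
    exact ⟨_, hfr hz, (normAtAllPlaces_dist_le _ _).trans_lt hd⟩
  have hAm : MeasurableSet A :=
    isClosed_cthickening.measurableSet.preimage (continuous_normAtAllPlaces K).measurable
  have hvol := volume_eq_two_pow_mul_two_pi_pow_mul_integral (A := A)
    Set.preimage_image_preimage hAm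
  have hV : volume (cthickening (2*ε) Bd) = ENNReal.ofReal (volume.real (cthickening (2*ε) Bd)) :=
    (ofReal_measureReal (hBdb.cthickening.measure_lt_top).ne).symm
  have hIntg : ∫⁻ x in normAtAllPlaces '' A, ∏ w : {w : InfinitePlace K // IsComplex w},
      ENNReal.ofReal (x w.1) ≤ ENNReal.ofReal (M ^ k * (C * 2 * ε)) := by
    calc _ ≤ ∫⁻ x in cthickening (2*ε) Bd, ∏ w : {w : InfinitePlace K // IsComplex w},
          ENNReal.ofReal (x w.1) := lintegral_mono_set (image_preimage_subset _ _)
      _ ≤ ∫⁻ x in cthickening (2*ε) Bd, ENNReal.ofReal (M ^ k) := by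
        refine setLIntegral_mono measurable_const fun x hx => ?_
        have hx1 : ‖x‖ ≤ M := hM x (cthickening_mono (by linarith) _ hx)
        have hxw : ∀ w, x w ≤ M := fun w =>
          (le_abs_self _).trans ((norm_le_pi_norm x w).trans hx1)
        calc _ ≤ ∏ w : {w : InfinitePlace K // IsComplex w}, ENNReal.ofReal M :=
              Finset.prod_le_prod' fun w _ => ENNReal.ofReal_le_ofReal (hxw w.1)
          _ = _ := by
            rw [Finset.prod_const, ENNReal.ofReal_pow hM0.le]; rfl
      _ = ENNReal.ofReal (M ^ k) * volume (cthickening (2*ε) Bd) := by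
        rw [setLIntegral_const]
      _ ≤ _ := by
        rw [hV, ← ENNReal.ofReal_mul (by positivity)]
        refine ENNReal.ofReal_le_ofReal ?_
        gcongr
        have := hC (2*ε) (by positivity) (by linarith)
        linarith
  have hAle : volume A ≤ ENNReal.ofReal (2 ^ nrRealPlaces K * (2 * Real.pi) ^ nrComplexPlaces K * (M ^ k * (C * 2 * ε))) := by
    rw [hvol, ENNReal.ofReal_mul (p := 2 ^ nrRealPlaces K * (2 * Real.pi) ^ nrComplexPlaces K)
      (by positivity), ENNReal.ofReal_mul (p := 2 ^ nrRealPlaces K) (by positivity),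
      ENNReal.ofReal_pow (by positivity), ENNReal.ofReal_pow (by positivity)]
    rw [show ENNReal.ofReal 2 = 2 from ENNReal.ofReal_ofNat 2]
    gcongr
  have hAtop : volume A ≠ ⊤ := (hAle.trans_lt ENNReal.ofReal_lt_top).ne
  refine (measureReal_mono hsub hAtop).trans ?_
  refine (ENNReal.toReal_le_of_le_ofReal (by positivity) hAle).trans (le_of_eq ?_)
  ring
end P2b

section P3
open MeasureTheory Metric Set NumberField NumberField.InfinitePlace NumberField.mixedEmbedding
  NumberField.mixedEmbedding.fundamentalCone NumberField.Units NumberField.Units.dirichletUnitTheorem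
open scoped nonZeroDivisors Pointwise

open scoped Classical in
theorem lattice_count (K : Type*) [Field K] [NumberField K] (L : Submodule ℤ (mixedSpace K))
    [DiscreteTopology L] [IsZLattice ℝ L] :
    ∃ C : ℝ, 0 ≤ C ∧ ∀ s : ℝ, 1 ≤ s →
      |(Nat.card ↑({x | x ∈ fundamentalCone K ∧ mixedEmbedding.norm x ≤ s} ∩
        (L : Set (mixedSpace K))) : ℝ) * ZLattice.covolume L volume
        - s * volume.real (normLeOne K)| ≤ C * s ^ (1 - 1 / (Module.finrank ℚ K : ℝ)) := by
  obtain ⟨D, hD, hL⟩ := card_lattice_bound (E := mixedSpace K) volume L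
  obtain ⟨C, hC0, hC⟩ := frontier_normLeOne_thickening K
  set n := Module.finrank ℚ K with hn
  have hnpos : 0 < n := Module.finrank_pos
  have hn1 : (1:ℝ) ≤ n := by exact_mod_cast hnpos
  obtain ⟨R, hR0, hR⟩ := (isBounded_normLeOne K).exists_pos_norm_le
  set M := volume.real (closedBall (0 : mixedSpace K) (2*D*R + 2 * D))
  refine ⟨C * D + M, by positivity, fun s hs => ?_⟩
  set t := s ^ (1 / (n:ℝ)) with ht
  have ht1 : 1 ≤ t := Real.one_le_rpow hs (by positivity)
  have ht0 : 0 < t := by linarith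
  have htn : t ^ n = s := by
    rw [ht, ← Real.rpow_natCast, ← Real.rpow_mul (by linarith)]
    field_simp
    simp
  have htn' : s ^ (1 - 1 / (n:ℝ)) = t ^ n / t := by
    rw [Real.rpow_sub (by linarith), Real.rpow_one, htn]
  have hSs : {x | x ∈ fundamentalCone K ∧ mixedEmbedding.norm x ≤ s} = t • normLeOne K := by
    ext x
    rw [mem_smul_set_iff_inv_smul_mem₀ ht0.ne', mem_normLeOne, smul_mem_iff_mem (inv_ne_zero ht0.ne'),
      mixedEmbedding.norm_smul, ← hn, abs_of_pos (by positivity), inv_pow, htn,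
      inv_mul_le_iff₀ (by linarith), mul_one]
    rfl
  have hfr : frontier (t • normLeOne K) = t • frontier (normLeOne K) := by
    rw [frontier, frontier, closure_smul₀ , interior_smul₀ ht0.ne', smul_set_sdiff₀ ht0.ne']
  have hvol : volume.real (t • normLeOne K) = s * volume.real (normLeOne K) := by
    rw [measureReal_def, Measure.addHaar_smul_of_nonneg _ ht0.le, mixedEmbedding.finrank, ← hn, htn,
      ENNReal.toReal_mul, ENNReal.toReal_ofReal (by linarith), measureReal_def]
  have hmain := hL (t • normLeOne K) ((measurableSet_normLeOne K).const_smul₀ t)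
    ((isBounded_normLeOne K).smul₀ t)
  rw [hSs, ← hvol]
  refine hmain.trans ?_
  rw [hfr, htn']
  have hs1 : 1 ≤ t ^ n / t := by
    rw [← htn']; exact Real.one_le_rpow hs (by
      rw [sub_nonneg, div_le_one (by linarith)]; exact hn1)
  have hfb : Bornology.IsBounded (frontier (normLeOne K)) :=
    (isBounded_normLeOne K).closure.subset frontier_subset_closure
  by_cases hcase : 2 * D ≤ t
  · have hsub : cthickening D (t • frontier (normLeOne K)) ⊆
        t • cthickening (D / t) (frontier (normLeOne K)) := by
      intro x hx
      rw [mem_smul_set_iff_inv_smul_mem₀ ht0.ne']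
      rw [mem_cthickening_iff] at hx ⊢
      have : x = t • (t⁻¹ • x) := by rw [smul_smul, mul_inv_cancel₀ ht0.ne', one_smul]
      rw [this, infEDist_smul₀ ht0.ne'] at hx
      rw [ENNReal.ofReal_div_of_pos ht0, ENNReal.le_div_iff_mul_le (by simp [ht0]) (by simp)]
      refine le_trans (le_of_eq ?_) hx
      rw [ENNReal.smul_def, smul_eq_mul, mul_comm]
      congr 1
      rw [← Real.norm_of_nonneg ht0.le, ← coe_nnnorm, ENNReal.ofReal_coe_nnreal]
      simp
    have hfin : volume (t • cthickening (D / t) (frontier (normLeOne K))) ≠ ⊤ :=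
      (hfb.cthickening.smul₀ t).measure_lt_top.ne
    refine (measureReal_mono hsub hfin).trans ?_
    rw [measureReal_def, Measure.addHaar_smul_of_nonneg _ ht0.le, mixedEmbedding.finrank, ← hn,
      ENNReal.toReal_mul, ENNReal.toReal_ofReal (by positivity), ← measureReal_def]
    have := hC (D / t) (by positivity) (by rw [div_le_iff₀ ht0]; linarith)
    calc _ ≤ t ^ n * (C * (D / t)) := by gcongr
      _ = C * D * (t ^ n / t) := by ring
      _ ≤ _ := by
        gcongr
        have : 0 ≤ M := measureReal_nonneg
        linarith
  · push Not at hcase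
    have hsub : cthickening D (t • frontier (normLeOne K)) ⊆ closedBall 0 (2*D*R+2*D) := by
      intro x hx
      have hx2 := cthickening_subset_thickening' (by positivity : 0 < 2*D) (by linarith : D < 2*D) _ hx
      rw [mem_thickening_iff] at hx2
      obtain ⟨_, ⟨z, hz, rfl⟩, hd⟩ := hx2
      have hz' : ‖z‖ ≤ R := by
        have : closure (normLeOne K) ⊆ closedBall 0 R := closure_minimal (fun y hy => by
          simpa using hR y hy) isClosed_closedBall
        simpa using this hz.1
      rw [mem_closedBall, dist_zero_right]
      simp only at hd
      have : ‖x‖ ≤ dist x (t • z) + ‖t • z‖ := by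
        rw [dist_eq_norm]
        calc ‖x‖ = ‖(x - t • z) + t • z‖ := by simp
          _ ≤ _ := norm_add_le _ _
      have h2 : ‖t • z‖ ≤ 2 * D * R := by
        rw [_root_.norm_smul, Real.norm_of_nonneg ht0.le]
        gcongr
      linarith
    refine (measureReal_mono hsub measure_closedBall_lt_top.ne).trans ?_
    calc M ≤ (C * D + M) * 1 := by
          have : 0 ≤ C * D := by positivity
          linarith
      _ ≤ _ := by
        have : 0 ≤ M := measureReal_nonneg
        gcongr

theorem class_card_eq (K : Type*) [Field K] [NumberField K] {C : ClassGroup (𝓞 K)}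
    {J : (Ideal (𝓞 K))⁰} {s : ℝ} (hJ : ClassGroup.mk0 J = C⁻¹) :
    Nat.card {I : (Ideal (𝓞 K))⁰ // Ideal.absNorm (I : Ideal (𝓞 K)) ≤ s ∧ ClassGroup.mk0 I = C}
      = Nat.card {I : (Ideal (𝓞 K))⁰ // (J : Ideal (𝓞 K)) ∣ I ∧
        Submodule.IsPrincipal (I : Ideal (𝓞 K)) ∧
        Ideal.absNorm (I : Ideal (𝓞 K)) ≤ s * Ideal.absNorm (J : Ideal (𝓞 K))} := by
  simp_rw [← nonZeroDivisors_dvd_iff_dvd_coe]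
  refine Nat.card_congr ?_
  refine ((Equiv.dvd J).subtypeEquiv fun I ↦ ?_).trans
    (Equiv.subtypeSubtypeEquivSubtypeInter (fun I : (Ideal (𝓞 K))⁰ ↦ J ∣ I) _)
  rw [← ClassGroup.mk0_eq_one_iff (SetLike.coe_mem _)]
  simp_rw [Equiv.dvd_apply, Submonoid.coe_mul, ← Submonoid.mul_def, _root_.map_mul, hJ,
    inv_mul_eq_one, Nat.cast_mul, mul_comm s, eq_comm, and_comm, and_congr_left_iff]
  exact fun _ ↦
    (mul_le_mul_iff_of_pos_left (Nat.cast_pos.mpr (Ideal.absNorm_pos_of_nonZeroDivisors J))).symm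

theorem class_count (K : Type*) [Field K] [NumberField K] (C : ClassGroup (𝓞 K)) :
    ∃ κ B : ℝ, 0 ≤ B ∧ ∀ s : ℝ, 1 ≤ s →
      |(Nat.card {I : (Ideal (𝓞 K))⁰ //
        Ideal.absNorm (I : Ideal (𝓞 K)) ≤ s ∧ ClassGroup.mk0 I = C} : ℝ) - κ * s| ≤
        B * s ^ (1 - 1 / (Module.finrank ℚ K : ℝ)) := by
  classical
  obtain ⟨J, hJ⟩ := ClassGroup.mk0_surjective C⁻¹
  set L := mixedEmbedding.idealLattice K (FractionalIdeal.mk0 K J) with hL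
  obtain ⟨B, hB0, hB⟩ := lattice_count K L
  set N : ℝ := (Ideal.absNorm (J : Ideal (𝓞 K)) : ℝ) with hN
  have hN1 : 1 ≤ N := by
    have := Ideal.absNorm_pos_of_nonZeroDivisors J
    rw [hN]; exact_mod_cast this
  set c := ZLattice.covolume L volume with hc
  have hc0 : 0 < c := ZLattice.covolume_pos L volume
  set w : ℝ := (torsionOrder K : ℝ) with hw
  have hw0 : 0 < w := by
    have := torsionOrder_pos K
    rw [hw]; exact_mod_cast this
  refine ⟨N * volume.real (normLeOne K) / (w * c), B * N ^ (1 - 1 / (Module.finrank ℚ K : ℝ)) / (w * c),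
    by positivity, fun s hs => ?_⟩
  have h1 := hB (s * N) (by nlinarith)
  have hset : idealSet K J = fundamentalCone K ∩ (L : Set (mixedSpace K)) := rfl
  have hcard : Nat.card ↑({x | x ∈ fundamentalCone K ∧ mixedEmbedding.norm x ≤ s * N} ∩
        (L : Set (mixedSpace K))) =
      Nat.card {a : idealSet K J // mixedEmbedding.norm (a : mixedSpace K) ≤ s * N} := by
    refine Nat.card_congr ?_
    refine Equiv.symm ((Equiv.subtypeSubtypeEquivSubtypeInter _ (mixedEmbedding.norm · ≤ s * N)).trans
      (Equiv.subtypeEquivProp ?_))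
    ext x
    simp only [hset]
    constructor
    · rintro ⟨⟨h1, h2⟩, h3⟩; exact ⟨⟨h1, h3⟩, h2⟩
    · rintro ⟨⟨h1, h3⟩, h2⟩; exact ⟨⟨h1, h2⟩, h3⟩
  rw [hcard, ← card_isPrincipal_dvd_norm_le, ← class_card_eq K hJ, Nat.cast_mul, ← hw] at h1
  set a : ℝ := (Nat.card {I : (Ideal (𝓞 K))⁰ //
        Ideal.absNorm (I : Ideal (𝓞 K)) ≤ s ∧ ClassGroup.mk0 I = C} : ℝ)
  rw [Real.mul_rpow (by linarith) (by linarith)] at h1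
  have e1 : a - N * volume.real (normLeOne K) / (w * c) * s
      = (a * w * c - s * N * volume.real (normLeOne K)) / (w * c) := by field_simp
  rw [e1, abs_div, abs_of_pos (by positivity : 0 < w * c), div_le_iff₀ (by positivity)]
  refine h1.trans (le_of_eq ?_)
  field_simp

theorem ideal_count (K : Type*) [Field K] [NumberField K] :
    ∃ κ B : ℝ, 0 < κ ∧ 0 ≤ B ∧ ∀ s : ℝ, 1 ≤ s →
      |(Nat.card {I : (Ideal (𝓞 K))⁰ // Ideal.absNorm (I : Ideal (𝓞 K)) ≤ s} : ℝ) - κ * s| ≤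
        B * s ^ (1 - 1 / (Module.finrank ℚ K : ℝ)) := by
  classical
  choose κ B hB0 hB using class_count K
  have hbound : ∀ s : ℝ, 1 ≤ s →
      |(Nat.card {I : (Ideal (𝓞 K))⁰ // Ideal.absNorm (I : Ideal (𝓞 K)) ≤ s} : ℝ) - (∑ C, κ C) * s| ≤
        (∑ C, B C) * s ^ (1 - 1 / (Module.finrank ℚ K : ℝ)) := by
    intro s hs
    have hcard : (Nat.card {I : (Ideal (𝓞 K))⁰ // Ideal.absNorm (I : Ideal (𝓞 K)) ≤ s} : ℝ) =
        ∑ C : ClassGroup (𝓞 K), (Nat.card {I : (Ideal (𝓞 K))⁰ //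
        Ideal.absNorm (I : Ideal (𝓞 K)) ≤ s ∧ ClassGroup.mk0 I = C} : ℝ) := by
      have : Fintype {I : (Ideal (𝓞 K))⁰ // Ideal.absNorm (I : Ideal (𝓞 K)) ≤ s} := by
        simp_rw [← Nat.le_floor_iff (by linarith : 0 ≤ s)]
        refine @Fintype.ofFinite _ (Ideal.finite_setOfPred_absNorm_le₀ ⌊s⌋₊)
      let e := fun C : ClassGroup (𝓞 K) ↦ Equiv.subtypeSubtypeEquivSubtypeInter
        (fun I : (Ideal (𝓞 K))⁰ ↦ Ideal.absNorm I.1 ≤ s) (fun I ↦ ClassGroup.mk0 I = C)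
      simp_rw [← Nat.card_congr (e _), Nat.card_eq_fintype_card, Fintype.subtype_card]
      rw [Fintype.card, Finset.card_eq_sum_card_fiberwise (f := fun I ↦ ClassGroup.mk0 I.1)
        (t := Finset.univ) (fun _ _ ↦ Finset.mem_univ _), Nat.cast_sum]
    rw [hcard, Finset.sum_mul, Finset.sum_mul, ← Finset.sum_sub_distrib]
    exact (Finset.abs_sum_le_sum_abs _ _).trans (Finset.sum_le_sum fun C _ => hB C s hs)
  refine ⟨∑ C, κ C, ∑ C, B C, ?_, Finset.sum_nonneg fun C _ => hB0 C, hbound⟩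
  have hlim := NumberField.Ideal.tendsto_norm_le_div_atTop₀ K
  have hn0 : 0 < (Module.finrank ℚ K : ℝ) := by exact_mod_cast Module.finrank_pos (R := ℚ) (M := K)
  have hlim2 : Filter.Tendsto (fun s : ℝ ↦
      (Nat.card {I : (Ideal (𝓞 K))⁰ // Ideal.absNorm (I : Ideal (𝓞 K)) ≤ s} : ℝ) / s) Filter.atTop
      (nhds (∑ C, κ C)) := by
    rw [tendsto_iff_dist_tendsto_zero]
    have h0 : Filter.Tendsto (fun s : ℝ => (∑ C, B C) * s ^ (-(1 / (Module.finrank ℚ K : ℝ))))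
        Filter.atTop (nhds 0) := by
      have := (tendsto_rpow_neg_atTop (y := 1 / (Module.finrank ℚ K : ℝ)) (by positivity)).const_mul
        (∑ C, B C)
      simpa using this
    refine squeeze_zero' (Filter.Eventually.of_forall fun _ => dist_nonneg) ?_ h0
    filter_upwards [Filter.eventually_ge_atTop 1] with s hs
    have hs0 : 0 < s := by linarith
    have := hbound s hs
    rw [Real.dist_eq]
    have e : ∀ a k : ℝ, a / s - k = (a - k * s) / s := fun a k => by field_simp
    rw [e, abs_div, abs_of_pos hs0, div_le_iff₀ hs0]
    refine this.trans (le_of_eq ?_)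
    rw [mul_assoc, ← Real.rpow_add_one hs0.ne']
    congr 2
    ring
  rw [tendsto_nhds_unique hlim2 hlim]
  have := regulator_pos K
  have h2 : 0 < torsionOrder K := torsionOrder_pos K
  have h3 : (0:ℝ) < |(discr K : ℝ)| := abs_pos.2 (by exact_mod_cast discr_ne_zero K)
  have h4 : 0 < classNumber K := Fintype.card_pos
  positivity
end P3

section P4
open MeasureTheory Set Filter Topology Complex

theorem zeta_cont (a : ℕ → ℝ) (ha : ∀ n, 0 ≤ a n) (κ B δ : ℝ) (hδ0 : 0 < δ) (hδ1 : δ ≤ 1)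
    (hB0 : 0 ≤ B)
    (hA : ∀ t : ℝ, 1 ≤ t → |(∑ k ∈ Finset.Icc 1 ⌊t⌋₊, a k) - κ * t| ≤ B * t ^ (1 - δ)) :
    (∀ s : ℂ, 1 < s.re → LSeriesSummable (fun n => (a n : ℂ)) s) ∧
    ∃ H : ℂ → ℂ, DifferentiableOn ℂ H {s | 1 - δ < s.re} ∧ H 1 = κ ∧
      ∀ s : ℂ, 1 < s.re → H s = (s - 1) * LSeries (fun n => (a n : ℂ)) s := by
  have hO : (fun n : ℕ ↦ ∑ k ∈ Finset.Icc 1 n, a k) =O[atTop] fun n ↦ (n : ℝ) ^ (1:ℝ) := by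
    refine Asymptotics.IsBigO.of_bound (B + |κ|) ?_
    filter_upwards [eventually_ge_atTop 1] with n hn
    have hn1 : (1:ℝ) ≤ n := by exact_mod_cast hn
    have h := hA n hn1
    rw [Nat.floor_natCast] at h
    have h2 : (n:ℝ) ^ (1 - δ) ≤ n := by
      calc (n:ℝ) ^ (1 - δ) ≤ (n:ℝ) ^ (1:ℝ) := Real.rpow_le_rpow_of_exponent_le hn1 (by linarith)
        _ = n := Real.rpow_one _
    rw [Real.rpow_one, Real.norm_eq_abs, Real.norm_eq_abs, abs_of_pos (by linarith : (0:ℝ) < n)]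
    have h3 := abs_sub_abs_le_abs_sub (∑ k ∈ Finset.Icc 1 n, a k) (κ * n)
    rw [abs_mul κ, abs_of_pos (by linarith : (0:ℝ) < n)] at h3
    nlinarith
  have hsum : ∀ s : ℂ, 1 < s.re → LSeriesSummable (fun n => (a n : ℂ)) s := fun s hs =>
    LSeriesSummable_of_sum_norm_bigO_and_nonneg hO ha zero_le_one hs
  refine ⟨hsum, ?_⟩
  set A : ℝ → ℝ := fun t => ∑ k ∈ Finset.Icc 1 ⌊t⌋₊, a k with hAdef
  have hAm : Measurable A :=
    (measurable_from_nat (f := fun n => ∑ k ∈ Finset.Icc 1 n, a k)).comp Nat.measurable_floor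
  set E : ℝ → ℂ := (Ioi (1:ℝ)).indicator (fun t => ((A t - κ * t : ℝ) : ℂ)) with hE
  have hEm : Measurable E :=
    (measurable_ofReal.comp (hAm.sub (measurable_const.mul measurable_id))).indicator measurableSet_Ioi
  have hEb : ∀ t : ℝ, 1 ≤ t → ‖E t‖ ≤ B * t ^ (1 - δ) := by
    intro t ht
    rw [hE]
    by_cases h1 : t ∈ Ioi (1:ℝ)
    · rw [indicator_of_mem h1, norm_real]; exact hA t ht
    · rw [indicator_of_notMem h1, norm_zero]; positivity
  have hE0 : ∀ t : ℝ, t ≤ 1 → E t = 0 := fun t ht => by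
    rw [hE, indicator_of_notMem (by simpa using ht)]
  have hEloc : LocallyIntegrableOn E (Ioi 0) := by
    have hmaj : LocallyIntegrable (fun t : ℝ => B * (1 + |t|)) volume :=
      Continuous.locallyIntegrable (by fun_prop)
    refine (hmaj.mono hEm.aestronglyMeasurable (Eventually.of_forall fun t => ?_)).locallyIntegrableOn _
    rw [Real.norm_of_nonneg (by positivity)]
    rcases le_total t 1 with h | h
    · rw [hE0 t h, norm_zero]; positivity
    · refine (hEb t h).trans ?_
      gcongr
      calc t ^ (1 - δ) ≤ t ^ (1:ℝ) := Real.rpow_le_rpow_of_exponent_le h (by linarith)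
        _ = t := Real.rpow_one _
        _ ≤ 1 + |t| := by linarith [le_abs_self t]
  have hEtop : E =O[atTop] (· ^ (-(-(1 - δ))) : ℝ → ℝ) := by
    refine Asymptotics.IsBigO.of_bound B ?_
    filter_upwards [eventually_ge_atTop 1] with t ht
    rw [neg_neg, Real.norm_of_nonneg (by positivity)]
    exact hEb t ht
  have hEbot : ∀ b : ℝ, E =O[𝓝[>] 0] (· ^ (-b) : ℝ → ℝ) := by
    intro b
    refine Asymptotics.IsBigO.of_bound 0 ?_
    filter_upwards [Ioo_mem_nhdsGT (zero_lt_one)] with t ht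
    rw [hE0 t ht.2.le]; simp
  refine ⟨fun s => κ * s + s * (s - 1) * mellin E (-s), ?_, by simp, ?_⟩
  · intro s hs
    have hd : DifferentiableAt ℂ (mellin E) (-s) :=
      mellin_differentiableAt_of_isBigO_rpow hEloc hEtop (by
        simp only [neg_re]; simp only [mem_ofPred_eq] at hs; linarith) (hEbot (-s.re - 1))
        (by simp)
    have hd2 : DifferentiableAt ℂ (fun s => mellin E (-s)) s :=
      DifferentiableAt.comp (g := mellin E) (f := fun s : ℂ => -s) s hd differentiableAt_id.neg
    refine DifferentiableAt.differentiableWithinAt ?_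
    fun_prop
  · intro s hs
    have hs1 : s - 1 ≠ 0 := by
      intro h
      have := congrArg re h
      simp at this; linarith
    rw [LSeries_eq_mul_integral_of_nonneg a zero_le_one hs hO ha]
    have hconv : MellinConvergent E (-s) :=
      mellinConvergent_of_isBigO_rpow hEloc hEtop (by
        simp only [neg_re]; linarith) (hEbot (-s.re - 1)) (by simp)
    have hmell : mellin E (-s) = ∫ t in Ioi (1:ℝ), (t : ℂ) ^ (-s - 1) * (A t - κ * t : ℝ) := by
      rw [mellin]
      have : ∀ t : ℝ, (t : ℂ) ^ (-s - 1) • E t =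
          (Ioi (1:ℝ)).indicator (fun t : ℝ => (t : ℂ) ^ (-s - 1) * (A t - κ * t : ℝ)) t := by
        intro t
        rw [hE]
        by_cases h : t ∈ Ioi (1:ℝ)
        · simp only [indicator_of_mem h, smul_eq_mul]
        · simp only [indicator_of_notMem h, smul_zero]
      simp_rw [this]
      rw [setIntegral_indicator measurableSet_Ioi, Ioi_inter_Ioi]
      norm_num
    have hint1 : IntegrableOn (fun t : ℝ => (t : ℂ) ^ (-s - 1) * (A t - κ * t : ℝ)) (Ioi 1) := by
      have := hconv.mono_set (Ioi_subset_Ioi zero_le_one : Ioi (1:ℝ) ⊆ Ioi 0)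
      refine this.congr_fun (fun t ht => ?_) measurableSet_Ioi
      simp only [hE, indicator_of_mem ht, smul_eq_mul]
    have hint2 : IntegrableOn (fun t : ℝ => (κ:ℂ) * (t : ℂ) ^ (-s)) (Ioi 1) :=
      (integrableOn_Ioi_cpow_of_lt (by simpa using hs) zero_lt_one).const_mul _
    have hI : ∫ t in Ioi (1:ℝ), (∑ k ∈ Finset.Icc 1 ⌊t⌋₊, (a k : ℂ)) * t ^ (-(s + 1)) =
        mellin E (-s) + κ * (1 / (s - 1)) := by
      have h3 : ∫ t in Ioi (1:ℝ), (κ:ℂ) * (t : ℂ) ^ (-s) = κ * (1 / (s - 1)) := by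
        rw [integral_const_mul, integral_Ioi_cpow_of_lt (by simpa using hs) zero_lt_one]
        congr 1
        rw [ofReal_one, one_cpow, show -s + 1 = -(s - 1) by ring, neg_div_neg_eq]
      rw [← h3, hmell, ← integral_add hint1 hint2]
      refine setIntegral_congr_fun measurableSet_Ioi fun t ht => ?_
      have ht0 : (t:ℂ) ≠ 0 := by
        have : (0:ℝ) < t := lt_trans zero_lt_one ht
        exact_mod_cast this.ne'
      simp only [hAdef]
      rw [show -(s+1) = -s - 1 by ring, cpow_sub _ _ ht0, cpow_one]
      push_cast
      field_simp
      ring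
    rw [hI]
    field_simp
    ring

open NumberField nonZeroDivisors

/-- number of ideals of norm n -/
noncomputable def idealCount (K : Type*) [Field K] [NumberField K] (n : ℕ) : ℕ :=
  Nat.card {I : Ideal (𝓞 K) // Ideal.absNorm I = n}

theorem zeta_K_cont (K : Type*) [Field K] [NumberField K] :
    (∀ s : ℂ, 1 < s.re → LSeriesSummable (fun n => (idealCount K n : ℂ)) s) ∧
    ∃ δ : ℝ, 0 < δ ∧ ∃ H : ℂ → ℂ, DifferentiableOn ℂ H {s | 1 - δ < s.re} ∧ H 1 ≠ 0 ∧
      ∀ s : ℂ, 1 < s.re → H s = (s - 1) * LSeries (fun n => (idealCount K n : ℂ)) s := by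
  obtain ⟨κ, B, hκ, hB0, h⟩ := ideal_count K
  have hn0 : 1 ≤ (Module.finrank ℚ K : ℝ) := by exact_mod_cast Module.finrank_pos (R := ℚ) (M := K)
  obtain ⟨h1, H, hH1, hH2, hH3⟩ := zeta_cont (fun n => (idealCount K n : ℝ)) (fun n => Nat.cast_nonneg _) κ B
    (1 / (Module.finrank ℚ K : ℝ)) (by positivity) (by rw [div_le_one (by linarith)]; exact hn0) hB0 (by
      intro t ht
      convert h t ht using 4
      rw [← Nat.cast_sum]
      congr 1
      simp_rw [← Nat.le_floor_iff (by linarith : 0 ≤ t)]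
      simp only [idealCount]
      rw [← add_left_inj 1, ← Ideal.card_norm_le_eq_card_norm_le_add_one,
        show Finset.Icc 1 ⌊t⌋₊ = Finset.Ioc 0 ⌊t⌋₊ from Finset.Icc_succ_left_eq_Ioc _ _,
        show 1 = Nat.card {I : Ideal (𝓞 K) // Ideal.absNorm I = 0} by simp [Ideal.absNorm_eq_zero_iff],
        Finset.sum_Ioc_add_eq_sum_Icc (Nat.zero_le _),
        ← Finset.card_preimage_eq_sum_card_image_eq (fun k _ ↦ Ideal.finite_setOfPred_absNorm_eq k)]
      simp [Set.coe_eq_subtype])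
  simp only [ofReal_natCast] at h1 hH3
  refine ⟨h1, _, by positivity, H, hH1, ?_, hH3⟩
  rw [hH2]
  exact_mod_cast hκ.ne'
end P4

section P5
open NumberField UniqueFactorizationMonoid
variable (K : Type*) [Field K] [NumberField K]

open Classical in
/-- pairs (P,k), P prime, k ≥ 1, N(P)^k = m -/
noncomputable def primePairs (m : ℕ) : Finset (Ideal (𝓞 K) × ℕ) :=
  (((Ideal.finite_setOfPred_absNorm_le (S := 𝓞 K) m).toFinset) ×ˢ Finset.Icc 1 m).filter
    (fun q => Prime q.1 ∧ Ideal.absNorm q.1 ^ q.2 = m)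

theorem two_le_norm_of_prime {P : Ideal (𝓞 K)} (hP : Prime P) : 2 ≤ Ideal.absNorm P := by
  have h0 : Ideal.absNorm P ≠ 0 := by
    rw [Ne, Ideal.absNorm_eq_zero_iff]; exact hP.ne_zero
  have h1 : Ideal.absNorm P ≠ 1 := by
    rw [Ne, Ideal.absNorm_eq_one_iff]
    intro h; exact hP.not_isUnit (by rw [h, ← Ideal.one_eq_top]; exact isUnit_one)
  omega

theorem mem_primePairs (m : ℕ) (q : Ideal (𝓞 K) × ℕ) :
    q ∈ primePairs K m ↔ Prime q.1 ∧ 1 ≤ q.2 ∧ Ideal.absNorm q.1 ^ q.2 = m := by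
  classical
  simp only [primePairs, Finset.mem_filter, Finset.mem_product, Set.Finite.mem_toFinset,
    Set.mem_ofPred_eq, Finset.mem_Icc]
  constructor
  · tauto
  · rintro ⟨h1, h2, h3⟩
    have h4 := two_le_norm_of_prime K h1
    refine ⟨⟨?_, h2, ?_⟩, h1, h3⟩
    · rw [← h3]; exact Nat.le_self_pow (by omega) _
    · rw [← h3]; exact (Nat.lt_pow_self (by omega)).le

/-- Von Mangoldt function of `K`, collected by norm. -/
noncomputable def vm (m : ℕ) : ℝ := ∑ q ∈ primePairs K m, Real.log (Ideal.absNorm q.1)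

open Classical in
noncomputable def ppDiv (I : Ideal (𝓞 K)) : Finset (Ideal (𝓞 K) × ℕ) :=
  ((normalizedFactors I).toFinset.sigma
    (fun P => Finset.Icc 1 ((normalizedFactors I).count P))).image (fun x => (x.1, x.2))

theorem mem_ppDiv (I : Ideal (𝓞 K)) (hI : I ≠ 0) (q : Ideal (𝓞 K) × ℕ) :
    q ∈ ppDiv K I ↔ Prime q.1 ∧ 1 ≤ q.2 ∧ q.1 ^ q.2 ∣ I := by
  classical
  simp only [ppDiv, Finset.mem_image, Finset.mem_sigma, Multiset.mem_toFinset, Finset.mem_Icc]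
  have key : ∀ P : Ideal (𝓞 K), Prime P → ∀ k : ℕ, k ≤ (normalizedFactors I).count P ↔ P ^ k ∣ I := by
    intro P hP k
    rw [pow_dvd_iff_le_emultiplicity, emultiplicity_eq_count_normalizedFactors hP.irreducible hI,
      normalize_eq]
    exact_mod_cast Iff.rfl
  constructor
  · rintro ⟨x, ⟨h1, h2, h3⟩, rfl⟩
    have hp := prime_of_normalized_factor _ h1
    exact ⟨hp, h2, (key _ hp _).1 h3⟩
  · rintro ⟨h1, h2, h3⟩
    have := (key _ h1 _).2 h3
    refine ⟨⟨q.1, q.2⟩, ⟨?_, h2, this⟩, rfl⟩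
    exact Multiset.count_pos.1 (lt_of_lt_of_le h2 this)

theorem sum_ppDiv (I : Ideal (𝓞 K)) (hI : I ≠ 0) :
    ∑ q ∈ ppDiv K I, Real.log (Ideal.absNorm q.1) = Real.log (Ideal.absNorm I) := by
  classical
  rw [ppDiv, Finset.sum_image, Finset.sum_sigma]
  · simp only [Finset.sum_const, Nat.card_Icc, Nat.add_sub_cancel, nsmul_eq_mul]
    have h1 : Ideal.absNorm I = ((normalizedFactors I).map Ideal.absNorm).prod := by
      conv_lhs => rw [← Ideal.prod_normalizedFactors_eq_self (I := I) (by simpa using hI)]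
      rw [map_multiset_prod]
    rw [h1, Finset.prod_multiset_map_count]
    push_cast
    rw [Real.log_prod]
    · refine Finset.sum_congr rfl fun P _ => ?_
      rw [Real.log_pow]
    · intro P hP
      have := two_le_norm_of_prime K (prime_of_normalized_factor P (Multiset.mem_toFinset.1 hP))
      positivity
  · rintro ⟨a, b⟩ _ ⟨c, d⟩ _ h
    simp only [Prod.mk.injEq] at h
    obtain ⟨rfl, rfl⟩ := h
    rfl

theorem vm_nonneg (n : ℕ) : 0 ≤ vm K n := by
  refine Finset.sum_nonneg fun q hq => Real.log_natCast_nonneg _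

noncomputable def idS (n : ℕ) : Finset (Ideal (𝓞 K)) :=
  (Ideal.finite_setOfPred_absNorm_eq (S := 𝓞 K) n).toFinset

theorem mem_idS (n : ℕ) (I : Ideal (𝓞 K)) : I ∈ idS K n ↔ Ideal.absNorm I = n := by
  simp [idS]

theorem idealCount_eq (n : ℕ) : idealCount K n = (idS K n).card := by
  have : Fintype {I : Ideal (𝓞 K) // Ideal.absNorm I = n} :=
    (Ideal.finite_setOfPred_absNorm_eq (S := 𝓞 K) n).fintype
  rw [idealCount, Nat.card_eq_fintype_card, Fintype.card_of_subtype]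
  exact mem_idS K n

theorem vm_conv (n : ℕ) (hn : n ≠ 0) :
    ∑ p ∈ n.divisorsAntidiagonal, vm K p.1 * (idealCount K p.2 : ℝ) =
      idealCount K n * Real.log n := by
  classical
  have h1 : ∀ I ∈ idS K n, ∑ q ∈ ppDiv K I, Real.log (Ideal.absNorm q.1) = Real.log n := by
    intro I hI
    rw [mem_idS] at hI
    rw [sum_ppDiv, hI]
    intro h; rw [h] at hI; simp at hI; omega
  have h2 : (idealCount K n : ℝ) * Real.log n =
      ∑ I ∈ idS K n, ∑ q ∈ ppDiv K I, Real.log (Ideal.absNorm q.1) := by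
    rw [Finset.sum_congr rfl h1, Finset.sum_const, idealCount_eq, nsmul_eq_mul]
  rw [h2]
  simp_rw [vm, idealCount_eq, Finset.sum_mul]
  have h3 : ∀ p ∈ n.divisorsAntidiagonal, ∑ q ∈ primePairs K p.1,
      Real.log (Ideal.absNorm q.1) * ((idS K p.2).card : ℝ) =
      ∑ q ∈ primePairs K p.1, ∑ J ∈ idS K p.2, Real.log (Ideal.absNorm q.1) := by
    intro p _
    refine Finset.sum_congr rfl fun q _ => ?_
    rw [Finset.sum_const, nsmul_eq_mul, mul_comm]
  rw [Finset.sum_congr rfl h3]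
  simp_rw [← Finset.sum_product']
  rw [Finset.sum_sigma', Finset.sum_sigma']
  have hn0 : ∀ I : Ideal (𝓞 K), Ideal.absNorm I = n → I ≠ 0 := by
    intro I hI h; rw [h] at hI; simp at hI; omega
  symm
  refine Finset.sum_bij' (M := ℝ)
    (i := fun x _ => ⟨(Ideal.absNorm x.2.1 ^ x.2.2, n / Ideal.absNorm x.2.1 ^ x.2.2),
      (x.2, if h : x.2.1 ^ x.2.2 ∣ x.1 then h.choose else 0)⟩)
    (j := fun y _ => ⟨y.2.1.1 ^ y.2.1.2 * y.2.2, y.2.1⟩) ?_ ?_ ?_ ?_ ?_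
  · rintro ⟨I, P, k⟩ h
    simp only [Finset.mem_sigma, mem_idS] at h
    obtain ⟨hI, h⟩ := h
    rw [mem_ppDiv K I (hn0 I hI)] at h
    obtain ⟨hP, hk, hd⟩ := h
    have hs := hd.choose_spec
    simp only [Finset.mem_sigma, Finset.mem_product, mem_idS, mem_primePairs,
      Nat.mem_divisorsAntidiagonal]
    have hN : Ideal.absNorm P ^ k * Ideal.absNorm hd.choose = n := by
      rw [← map_pow, ← map_mul, ← hs, hI]
    have h0 : 0 < Ideal.absNorm P ^ k := by
      have := two_le_norm_of_prime K hP
      positivity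
    refine ⟨⟨?_, hn⟩, ⟨hP, hk, trivial⟩, ?_⟩
    · rw [Nat.mul_div_cancel' ⟨_, hN.symm⟩]
    · rw [dif_pos hd, ← hN, Nat.mul_div_cancel_left _ h0]
  · rintro ⟨⟨m, l⟩, ⟨P, k⟩, J⟩ h
    simp only [Finset.mem_sigma, Finset.mem_product, mem_idS, mem_primePairs,
      Nat.mem_divisorsAntidiagonal] at h
    obtain ⟨⟨h1, _⟩, ⟨hP, hk, hm⟩, hJ⟩ := h
    have hN : Ideal.absNorm (P ^ k * J) = n := by rw [map_mul, map_pow, hm, hJ, h1]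
    simp only [Finset.mem_sigma, mem_idS]
    refine ⟨hN, ?_⟩
    rw [mem_ppDiv K _ (hn0 _ hN)]
    exact ⟨hP, hk, dvd_mul_right _ _⟩
  · rintro ⟨I, P, k⟩ h
    simp only [Finset.mem_sigma, mem_idS] at h
    obtain ⟨hI, h⟩ := h
    rw [mem_ppDiv K I (hn0 I hI)] at h
    obtain ⟨hP, hk, hd⟩ := h
    simp only [dif_pos hd]
    rw [← hd.choose_spec]
  · rintro ⟨⟨m, l⟩, ⟨P, k⟩, J⟩ h
    simp only [Finset.mem_sigma, Finset.mem_product, mem_idS, mem_primePairs,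
      Nat.mem_divisorsAntidiagonal] at h
    obtain ⟨⟨h1, _⟩, ⟨hP, hk, hm⟩, hJ⟩ := h
    have hd : P ^ k ∣ P ^ k * J := dvd_mul_right _ _
    have hJ' : hd.choose = J := by
      have := hd.choose_spec
      exact (mul_left_cancel₀ (pow_ne_zero _ hP.ne_zero) this).symm
    have h0 : 0 < m := by
      rw [← hm]
      have := two_le_norm_of_prime K hP
      positivity
    simp only [dif_pos hd, hJ', hm]
    rw [← h1, Nat.mul_div_cancel_left _ h0]
  · rintro ⟨I, P, k⟩ h
    rfl

theorem vm_prime (p : ℕ) (hp : p.Prime) : vm K p = idealCount K p * Real.log p := by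
  classical
  have : primePairs K p = (idS K p).image (fun I => (I, 1)) := by
    ext ⟨P, k⟩
    simp only [mem_primePairs, Finset.mem_image, mem_idS, Prod.mk.injEq]
    constructor
    · rintro ⟨h1, h2, h3⟩
      have hk : k = 1 := by
        by_contra hk
        have : ¬ p.Prime := by
          rw [← h3]; exact Nat.Prime.not_prime_pow (by omega)
        exact this hp
      subst hk
      exact ⟨P, by simpa using h3, rfl, rfl⟩
    · rintro ⟨I, h1, rfl, rfl⟩
      refine ⟨?_, le_rfl, by simpa using h1⟩
      have : I.IsPrime := Ideal.isPrime_of_irreducible_absNorm (by rw [h1]; exact hp)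
      refine Ideal.prime_of_isPrime ?_ this
      intro h; rw [h] at h1; simp at h1; exact hp.ne_zero h1.symm
  rw [vm, this, Finset.sum_image (by intro a _ b _ h; simpa using h), idealCount_eq]
  rw [Finset.sum_congr rfl (g := fun _ => Real.log p) (fun I hI => by rw [(mem_idS K p I).1 hI]),
    Finset.sum_const, nsmul_eq_mul]

theorem prime_above {P : Ideal (𝓞 K)} (hP : Prime P) : ∃ p : ℕ, p.Prime ∧ (p : 𝓞 K) ∈ P := by
  have hPp : P.IsPrime := Ideal.isPrime_of_prime hP
  have h2 := two_le_norm_of_prime K hP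
  have hmem := Ideal.absNorm_mem P
  have key : ∀ n : ℕ, n ≠ 0 → (n : 𝓞 K) ∈ P → ∃ p : ℕ, p.Prime ∧ (p : 𝓞 K) ∈ P := by
    intro n
    induction n using Nat.recOnMul with
    | zero => intro h; exact absurd rfl h
    | one => intro _ h; exact absurd ((Ideal.eq_top_iff_one P).2 (by simpa using h)) hPp.ne_top
    | prime p hp => intro _ h; exact ⟨p, hp, h⟩
    | mul a b iha ihb =>
      intro h h'
      push_cast at h'
      rcases hPp.mem_or_mem h' with h1 | h1
      · exact iha (by rintro rfl; simp at h) h1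
      · exact ihb (by rintro rfl; simp at h) h1
  exact key _ (by omega) hmem

theorem norm_span_nat (p : ℕ) : Ideal.absNorm (Ideal.span {(p : 𝓞 K)}) = p ^ Module.finrank ℚ K := by
  rw [Ideal.absNorm_span_singleton, show (p : 𝓞 K) = algebraMap ℤ (𝓞 K) (p : ℤ) by simp,
    Algebra.norm_algebraMap, RingOfIntegers.rank, Int.natAbs_pow, Int.natAbs_natCast]

theorem vm_le (n : ℕ) : vm K n ≤ Module.finrank ℚ K * ArithmeticFunction.vonMangoldt n := by
  classical
  by_cases hne : (primePairs K n).Nonempty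
  swap
  · rw [Finset.not_nonempty_iff_eq_empty] at hne
    rw [vm, hne, Finset.sum_empty]
    have := ArithmeticFunction.vonMangoldt_nonneg (n := n)
    positivity
  obtain ⟨⟨P, k⟩, hPk⟩ := hne
  obtain ⟨hP, hk, hn⟩ := (mem_primePairs K n _).1 hPk
  simp only at hP hk hn
  obtain ⟨p, hp, hpP⟩ := prime_above K hP
  have hd : P ∣ Ideal.span {(p : 𝓞 K)} := by
    rw [Ideal.dvd_span_singleton]; exact hpP
  have hd2 := map_dvd Ideal.absNorm hd
  rw [norm_span_nat, Nat.dvd_prime_pow hp] at hd2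
  obtain ⟨j, _, hj⟩ := hd2
  have hj0 : j ≠ 0 := by
    rintro rfl
    have := two_le_norm_of_prime K hP
    rw [hj, pow_zero] at this
    omega
  have hnp : n = p ^ (j * k) := by rw [← hn, hj, pow_mul]
  have hjk : j * k ≠ 0 := Nat.mul_ne_zero hj0 (by omega)
  have hΛ : ArithmeticFunction.vonMangoldt n = Real.log p := by
    rw [hnp, ArithmeticFunction.vonMangoldt_apply_pow hjk, ArithmeticFunction.vonMangoldt_apply_prime hp]
  have hp0 : Ideal.span {(p : 𝓞 K)} ≠ 0 := by
    rw [Ne, Ideal.zero_eq_bot, Ideal.span_singleton_eq_bot]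
    exact_mod_cast hp.ne_zero
  have hlog : Real.log (Ideal.absNorm (Ideal.span {(p : 𝓞 K)})) = Module.finrank ℚ K * Real.log p := by
    rw [norm_span_nat]; push_cast; rw [Real.log_pow]
  rw [hΛ, ← hlog, ← sum_ppDiv K _ hp0, vm]
  have himg : (primePairs K n).image (fun q => (q.1, 1)) ⊆ ppDiv K (Ideal.span {(p : 𝓞 K)}) := by
    intro q hq
    obtain ⟨⟨Q, l⟩, hQ, rfl⟩ := Finset.mem_image.1 hq
    obtain ⟨hQ, hl, hn'⟩ := (mem_primePairs K n _).1 hQ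
    rw [mem_ppDiv K _ hp0]
    refine ⟨hQ, le_rfl, ?_⟩
    simp only at hQ hn'
    have hQp : Q.IsPrime := Ideal.isPrime_of_prime hQ
    rw [pow_one, Ideal.dvd_span_singleton]
    have hm : ((n : ℕ) : 𝓞 K) ∈ Q := by
      rw [← hn']; push_cast
      exact Ideal.pow_mem_of_mem _ (Ideal.absNorm_mem Q) _ (by omega)
    rw [hnp] at hm
    push_cast at hm
    exact hQp.mem_of_pow_mem _ hm
  refine le_trans (le_of_eq ?_) (Finset.sum_le_sum_of_subset_of_nonneg himg
    fun _ _ _ => Real.log_natCast_nonneg _)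
  rw [Finset.sum_image]
  rintro ⟨Q, l⟩ h1 ⟨Q', l'⟩ h2 h
  simp only [Prod.mk.injEq, and_true] at h
  subst h
  obtain ⟨hQ, hl, hn'⟩ := (mem_primePairs K n _).1 h1
  obtain ⟨_, _, hn''⟩ := (mem_primePairs K n _).1 h2
  simp only at hn' hn''
  rw [← hn''] at hn'
  have := Nat.pow_right_injective (two_le_norm_of_prime K hQ) hn'
  rw [this]

open LSeries in
theorem vm_summable (s : ℂ) (hs : 1 < s.re) : LSeriesSummable (fun n => (vm K n : ℂ)) s := by
  have h := ArithmeticFunction.LSeriesSummable_vonMangoldt hs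
  have h2 := (h.norm.mul_left (Module.finrank ℚ K : ℝ))
  refine Summable.of_norm_bounded h2 fun n => ?_
  rcases eq_or_ne n 0 with rfl | hn
  · simp
  rw [term_of_ne_zero hn, term_of_ne_zero hn, norm_div, norm_div, ← mul_div_assoc]
  gcongr
  rw [Complex.norm_real, Complex.norm_real, Real.norm_of_nonneg (vm_nonneg K n),
    Real.norm_of_nonneg ArithmeticFunction.vonMangoldt_nonneg]
  exact vm_le K n

open LSeries in
theorem abscissa_le : abscissaOfAbsConv (fun n => (idealCount K n : ℂ)) ≤ 1 :=
  abscissaOfAbsConv_le_of_forall_lt_LSeriesSummable (x := 1) fun y hy =>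
    (zeta_K_cont K).1 y (by simpa using hy)

open LSeries in
theorem vm_LSeries (s : ℂ) (hs : 1 < s.re) :
    LSeries (fun n => (vm K n : ℂ)) s * LSeries (fun n => (idealCount K n : ℂ)) s =
      - deriv (LSeries (fun n => (idealCount K n : ℂ))) s := by
  rw [LSeries_deriv ((abscissa_le K).trans_lt (by exact_mod_cast hs)), neg_neg,
    ← LSeries_convolution' (vm_summable K s hs) ((zeta_K_cont K).1 s hs)]
  refine LSeries_congr (fun {n} hn => ?_) s
  rw [convolution_def]
  have := vm_conv K n hn
  simp only [logMul, ← Complex.natCast_log]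
  rw [mul_comm]
  exact_mod_cast this
end P5

section P6
open Filter Topology Complex

theorem logDeriv_lim (H : ℂ → ℂ) (s₀ : ℂ) (hH : AnalyticAt ℂ H s₀) (ho : analyticOrderAt H s₀ ≠ ⊤) :
    ∃ m : ℕ, (m = 0 → H s₀ ≠ 0) ∧
      Tendsto (fun s => (s - s₀) * (deriv H s / H s)) (𝓝[≠] s₀) (𝓝 m) ∧
      ∀ᶠ s in 𝓝[≠] s₀, H s ≠ 0 := by
  obtain ⟨g, hg, hg0, hev⟩ := hH.analyticOrderAt_ne_top.1 ho
  set m := analyticOrderNatAt H s₀ with hm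
  have hgev : ∀ᶠ s in 𝓝 s₀, g s ≠ 0 := hg.continuousAt.eventually_ne hg0
  refine ⟨m, ?_, ?_, ?_⟩
  · intro h0
    rw [hev.self_of_nhds, h0]; simpa using hg0
  · have hlim : Tendsto (fun s => (m : ℂ) + (s - s₀) * (deriv g s / g s)) (𝓝[≠] s₀) (𝓝 m) := by
      have hc : ContinuousAt (fun s => (m : ℂ) + (s - s₀) * (deriv g s / g s)) s₀ := by
        have h1 := hg.deriv.continuousAt
        have h2 := hg.continuousAt
        exact continuousAt_const.add ((continuousAt_id.sub continuousAt_const).mul (h1.div h2 hg0))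
      have := hc.tendsto
      simp only [sub_self, zero_mul, add_zero] at this
      exact this.mono_left nhdsWithin_le_nhds
    refine hlim.congr' ?_
    have h1 := hev.eventually_nhds.filter_mono (nhdsWithin_le_nhds (s := {s₀}ᶜ))
    have h2 := hgev.filter_mono (nhdsWithin_le_nhds (s := {s₀}ᶜ))
    have h3 := hg.eventually_analyticAt.filter_mono (nhdsWithin_le_nhds (s := {s₀}ᶜ))
    filter_upwards [h1, h2, h3, self_mem_nhdsWithin] with s h1 h2 h3 h4
    have h5 : s - s₀ ≠ 0 := sub_ne_zero.2 h4
    have hd : deriv H s = m * (s - s₀) ^ (m - 1) * g s + (s - s₀) ^ m * deriv g s := by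
      have e : H =ᶠ[𝓝 s] fun z => (z - s₀) ^ m * g z := h1
      rw [e.deriv_eq]
      have : HasDerivAt (fun z => (z - s₀) ^ m * g z) _ s :=
        (((hasDerivAt_id s).sub_const s₀).pow m).mul h3.differentiableAt.hasDerivAt
      rw [this.deriv]
      simp
    rw [hd, h1.self_of_nhds, smul_eq_mul]
    rcases Nat.eq_zero_or_pos m with h0 | h0
    · rw [h0]; simp
    · obtain ⟨k, hk⟩ : ∃ k, m = k + 1 := ⟨m - 1, by omega⟩
      rw [hk, Nat.add_sub_cancel]
      field_simp
      ring
  · have h1 := hev.filter_mono (nhdsWithin_le_nhds (s := {s₀}ᶜ))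
    have h2 := hgev.filter_mono (nhdsWithin_le_nhds (s := {s₀}ᶜ))
    filter_upwards [h1, h2, self_mem_nhdsWithin] with s h1 h2 h4
    rw [h1, smul_eq_mul]
    exact mul_ne_zero (pow_ne_zero _ (sub_ne_zero.2 h4)) h2

theorem LSeries_re (a : ℕ → ℝ) (σ t : ℝ) (h : LSeriesSummable (fun n => (a n : ℂ)) σ) :
    Summable (fun n : ℕ => ‖LSeries.term (fun n => (a n : ℂ)) σ n‖) ∧
    HasSum (fun n : ℕ => (if n = 0 then 0 else a n * (n : ℝ) ^ (-σ)) * Real.cos (t * Real.log n))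
      (LSeries (fun n => (a n : ℂ)) (σ + t * I)).re := by
  refine ⟨h.norm, ?_⟩
  have h2 : LSeriesSummable (fun n => (a n : ℂ)) (σ + t * I) :=
    LSeriesSummable.of_re_le_re (by simp) h
  have h3 := hasSum_re h2.hasSum
  refine h3.congr_fun ?_
  intro n
  rcases eq_or_ne n 0 with rfl | hn
  · simp
  · rw [LSeries.term_of_ne_zero hn, if_neg hn]
    have hn0 : (0:ℝ) < n := by positivity
    have : (a n : ℂ) / (n : ℂ) ^ ((σ : ℂ) + t * I) =
        ((a n * (n:ℝ) ^ (-σ) : ℝ) : ℂ) * cexp (((-(t * Real.log n) : ℝ) : ℂ) * I) := by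
      rw [div_eq_mul_inv, ← cpow_neg, neg_add, cpow_add _ _ (by exact_mod_cast hn)]
      push_cast
      rw [ofReal_cpow hn0.le, cpow_def_of_ne_zero (x := (n : ℂ)) (y := -(t * I)) (by exact_mod_cast hn)]
      rw [← natCast_log]
      push_cast
      rw [mul_assoc]
      congr 3
      ring
    rw [this, re_ofReal_mul, exp_ofReal_mul_I_re, Real.cos_neg]

theorem three_four_one (a : ℕ → ℝ) (ha : ∀ n, 0 ≤ a n) (σ t : ℝ)
    (h : LSeriesSummable (fun n => (a n : ℂ)) σ) :
    0 ≤ 3 * (LSeries (fun n => (a n : ℂ)) σ).re + 4 * (LSeries (fun n => (a n : ℂ)) (σ + t * I)).re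
      + (LSeries (fun n => (a n : ℂ)) (σ + (2 * t : ℝ) * I)).re := by
  have h0 := (LSeries_re a σ 0 h).2
  have h1 := (LSeries_re a σ t h).2
  have h2 := (LSeries_re a σ (2 * t) h).2
  simp only [ofReal_zero, zero_mul, add_zero] at h0
  refine HasSum.nonneg ?_ (((h0.mul_left 3).add (h1.mul_left 4)).add h2)
  intro n
  simp only [Real.cos_zero, mul_one]
  have hc : 0 ≤ (if n = 0 then 0 else a n * (n : ℝ) ^ (-σ)) := by
    split_ifs
    · exact le_rfl
    · have := ha n; positivity
  rw [mul_assoc 2 t, Real.cos_two_mul]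
  set c := Real.cos (t * Real.log n)
  nlinarith [mul_nonneg hc (sq_nonneg (1 + c))]

theorem vm_ext (K : Type*) [Field K] [NumberField K] :
    ∃ G : ℂ → ℂ, ContinuousOn G {s | 1 ≤ s.re} ∧
      ∀ s : ℂ, 1 < s.re → LSeries (fun n => (vm K n : ℂ)) s = G s + 1 / (s - 1) := by
  obtain ⟨hsum, δ, hδ, H, hHd, hH1, hHz⟩ := zeta_K_cont K
  set U : Set ℂ := {s | 1 - δ < s.re} with hU
  have hUo : IsOpen U := isOpen_lt continuous_const continuous_re
  have hUc : IsPreconnected U := (convex_halfSpace_re_gt (1 - δ)).isPreconnected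
  have hHa : AnalyticOnNhd ℂ H U := hHd.analyticOnNhd hUo
  have h1U : (1:ℂ) ∈ U := by simp [hU, hδ]
  have ho : ∀ s ∈ U, analyticOrderAt H s ≠ ⊤ := by
    intro s hs
    refine hHa.analyticOrderAt_ne_top_of_isPreconnected hUc h1U hs ?_
    rw [((hHa 1 h1U).analyticOrderAt_eq_zero).2 hH1]
    exact ENat.zero_ne_top
  set L := LSeries (fun n => (vm K n : ℂ)) with hL
  -- the basic identity
  have hid : ∀ s : ℂ, 1 < s.re → H s ≠ 0 → L s = - (deriv H s / H s) + 1 / (s - 1) := by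
    intro s hs hs0
    have hs1 : s - 1 ≠ 0 := by
      intro h
      have := congrArg re h
      simp at this; linarith
    set Z := LSeries (fun n => (idealCount K n : ℂ)) with hZ
    have hev : H =ᶠ[𝓝 s] fun z => (z - 1) * Z z := by
      have : {z : ℂ | 1 < z.re} ∈ 𝓝 s := (isOpen_lt continuous_const continuous_re).mem_nhds hs
      filter_upwards [this] with z hz using hHz z hz
    have hZd : DifferentiableAt ℂ Z s :=
      (LSeries_hasDerivAt ((abscissa_le K).trans_lt (by exact_mod_cast hs))).differentiableAt
    have hd : deriv H s = Z s + (s - 1) * deriv Z s := by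
      rw [hev.deriv_eq]
      have : HasDerivAt (fun z => (z - 1) * Z z) _ s :=
        ((hasDerivAt_id s).sub_const 1).mul hZd.hasDerivAt
      rw [this.deriv]
      simp
    have hv := vm_LSeries K s hs
    rw [hHz s hs] at hs0 ⊢
    have hZ0 : Z s ≠ 0 := right_ne_zero_of_mul hs0
    have hdz : deriv Z s = - (L s * Z s) := by rw [hv, neg_neg]
    rw [hd, hdz]
    field_simp
    ring
  -- horizontal approach
  have happ : ∀ t : ℝ, Tendsto (fun σ : ℝ => (σ : ℂ) + t * I) (𝓝[>] 1) (𝓝[≠] (1 + t * I)) := by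
    intro t
    refine tendsto_nhdsWithin_iff.2 ⟨?_, ?_⟩
    · have : Continuous (fun σ : ℝ => (σ : ℂ) + t * I) := by fun_prop
      have h := this.tendsto 1
      rw [ofReal_one] at h
      exact h.mono_left nhdsWithin_le_nhds
    · filter_upwards [self_mem_nhdsWithin] with σ hσ h
      have := congrArg re (show (σ : ℂ) + t * I = 1 + t * I from h)
      simp at this
      have h2 : 1 < σ := hσ
      linarith
  have hUline : ∀ t : ℝ, (1 + t * I : ℂ) ∈ U := by
    intro t; simp [hU, hδ]
  have hlim : ∀ t : ℝ, ∃ m : ℕ, (m = 0 → H (1 + t * I) ≠ 0) ∧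
      Tendsto (fun σ : ℝ => (σ - 1) * (L (σ + t * I)).re) (𝓝[>] 1)
        (𝓝 (-(m:ℝ) + if t = 0 then 1 else 0)) := by
    intro t
    obtain ⟨m, hm0, hm1, hm2⟩ := logDeriv_lim H (1 + t * I) (hHa _ (hUline t)) (ho _ (hUline t))
    refine ⟨m, hm0, ?_⟩
    have h1 := hm1.comp (happ t)
    have h2 := (happ t).eventually hm2
    have h3 : Tendsto (fun σ : ℝ => ((σ:ℂ) - 1) * (1 / ((σ : ℂ) + t * I - 1))) (𝓝[>] 1)
        (𝓝 (if t = 0 then 1 else 0)) := by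
      by_cases ht : t = 0
      · rw [if_pos ht]
        refine tendsto_const_nhds.congr' ?_
        filter_upwards [self_mem_nhdsWithin] with σ hσ
        have : (σ:ℂ) - 1 ≠ 0 := by
          have h2 : 1 < σ := hσ
          intro h
          have := congrArg re h
          simp at this; linarith
        rw [ht]; simp [this]
      · rw [if_neg ht]
        have hc : ContinuousAt (fun σ : ℝ => ((σ:ℂ) - 1) * (1 / ((σ : ℂ) + t * I - 1))) 1 := by
          have : ((1:ℝ) : ℂ) + t * I - 1 ≠ 0 := by simp [ht]
          fun_prop (disch := assumption)
        have := hc.tendsto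
        simp only [ofReal_one, sub_self, zero_mul] at this
        exact this.mono_left nhdsWithin_le_nhds
    have h4 := h1.neg.add h3
    have h5 := (continuous_re.tendsto _).comp h4
    have e : re (-(m:ℂ) + if t = 0 then 1 else 0) = -(m:ℝ) + if t = 0 then 1 else 0 := by
      split_ifs <;> simp
    rw [e] at h5
    refine h5.congr' ?_
    filter_upwards [h2, self_mem_nhdsWithin] with σ h2 hσ
    have h2' : 1 < σ := hσ
    rw [hid _ (by simpa using h2') h2]
    simp only [Function.comp]
    rw [← re_ofReal_mul]
    congr 1
    push_cast
    ring
  have hne : ∀ t : ℝ, H (1 + t * I) ≠ 0 := by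
    intro t
    by_cases ht : t = 0
    · rw [ht]; simpa using hH1
    obtain ⟨m, hm, hml⟩ := hlim t
    obtain ⟨m2, _, hm2l⟩ := hlim (2 * t)
    obtain ⟨m0, _, hm0l⟩ := hlim 0
    apply hm
    by_contra hmne
    rw [if_neg ht] at hml
    rw [if_neg (by simpa using ht)] at hm2l
    rw [if_pos rfl] at hm0l
    have : 0 ≤ 3 * (-(m0:ℝ) + 1) + 4 * (-(m:ℝ) + 0) + (-(m2:ℝ) + 0) := by
      refine ge_of_tendsto (((hm0l.const_mul 3).add (hml.const_mul 4)).add hm2l) ?_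
      filter_upwards [self_mem_nhdsWithin] with σ hσ
      have h2 : 1 < σ := hσ
      have := three_four_one (vm K) (vm_nonneg K) σ t (vm_summable K σ (by simpa using h2))
      simp only [ofReal_zero, zero_mul, add_zero]
      have h3 := mul_nonneg (by linarith : 0 ≤ σ - 1) this
      rw [hL]
      linarith
    have hm1 : (1:ℝ) ≤ m := by exact_mod_cast Nat.one_le_iff_ne_zero.2 hmne
    have : (0:ℝ) ≤ m0 := Nat.cast_nonneg _
    have : (0:ℝ) ≤ m2 := Nat.cast_nonneg _
    linarith
  classical
  refine ⟨fun s => if 1 < s.re then L s - 1 / (s - 1) else - (deriv H s / H s), ?_, ?_⟩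
  · intro s hs
    rcases lt_or_eq_of_le (show 1 ≤ s.re from hs) with h | h
    · have hnh : {z : ℂ | 1 < z.re} ∈ 𝓝 s := (isOpen_lt continuous_const continuous_re).mem_nhds h
      have hab : LSeries.abscissaOfAbsConv (fun n => (vm K n : ℂ)) ≤ 1 :=
        LSeries.abscissaOfAbsConv_le_of_forall_lt_LSeriesSummable (x := 1) fun y hy =>
          vm_summable K y (by simpa using hy)
      have hLc : ContinuousAt L s :=
        (LSeries_hasDerivAt (hab.trans_lt (by exact_mod_cast h))).continuousAt
      have hs1 : s - 1 ≠ 0 := by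
        intro h'
        have := congrArg re h'
        simp at this; linarith
      have hc : ContinuousAt (fun s => L s - 1 / (s - 1)) s := by
        fun_prop (disch := assumption)
      refine (hc.congr ?_).continuousWithinAt
      filter_upwards [hnh] with z hz
      rw [if_pos hz]
    · have hsl : s = 1 + s.im * I := by
        apply Complex.ext <;> simp [← h]
      have hs0 : H s ≠ 0 := by rw [hsl]; exact hne _
      have hsU : s ∈ U := by rw [hsl]; exact hUline _
      have hHan := hHa s hsU
      have hev : ∀ᶠ z in 𝓝 s, H z ≠ 0 := hHan.continuousAt.eventually_ne hs0
      have hc : ContinuousAt (fun s => - (deriv H s / H s)) s :=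
        (hHan.deriv.continuousAt.div hHan.continuousAt hs0).neg
      refine (hc.congr ?_).continuousWithinAt
      filter_upwards [hev] with z hz
      split_ifs with h1
      · rw [hid z h1 hz]; ring
      · rfl
  · intro s hs
    simp only [if_pos hs]
    ring
end P6

section P7
open MeasureTheory Filter Topology

/-- Fejer kernel. -/
noncomputable def kk (l u : ℝ) : ℝ := 2 * ∫ t in (0:ℝ)..l, (1 - t / l) * Real.cos (t * u)

theorem kk_eq (l u : ℝ) (hl : 0 < l) (hu : u ≠ 0) :
    kk l u = 2 * (1 - Real.cos (l * u)) / (l * u ^ 2) := by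
  have hd : ∀ t ∈ Set.uIcc 0 l, HasDerivAt
      (fun t => (1 - t / l) * (Real.sin (t * u) / u) - Real.cos (t * u) / (l * u ^ 2))
      ((1 - t / l) * Real.cos (t * u)) t := by
    intro t _
    have h1 : HasDerivAt (fun t : ℝ => t * u) u t := by simpa using (hasDerivAt_id t).mul_const u
    have h2 : HasDerivAt (fun t : ℝ => 1 - t / l) (-(1 / l)) t := by
      simpa using ((hasDerivAt_id t).div_const l).const_sub 1
    have h3 := (h2.mul (h1.sin.div_const u)).sub (h1.cos.div_const (l * u ^ 2))
    refine HasDerivAt.congr_deriv (f := fun t => (1 - t / l) * (Real.sin (t * u) / u) - Real.cos (t * u) / (l * u ^ 2)) h3 ?_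
    field_simp
    ring
  rw [kk, intervalIntegral.integral_eq_sub_of_hasDerivAt hd
    (Continuous.intervalIntegrable (by fun_prop) _ _)]
  simp only [zero_mul, Real.cos_zero, Real.sin_zero]
  field_simp
  ring

theorem kk_le_two (l u : ℝ) (hl : 0 < l) : kk l u ≤ 2 * l := by
  rw [kk]
  have : ∫ t in (0:ℝ)..l, (1 - t / l) * Real.cos (t * u) ≤ ∫ t in (0:ℝ)..l, (1:ℝ) := by
    refine intervalIntegral.integral_mono_on hl.le (Continuous.intervalIntegrable (by fun_prop) _ _)
      (Continuous.intervalIntegrable (by fun_prop) _ _) fun t ht => ?_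
    have h1 : 0 ≤ t / l := div_nonneg ht.1 hl.le
    have h2 : t / l ≤ 1 := (div_le_one hl).2 ht.2
    nlinarith [Real.cos_le_one (t * u)]
  simp at this
  linarith

theorem int_hat (l : ℝ) (hl : 0 < l) : ∫ t in (0:ℝ)..l, (1 - t / l) = l / 2 := by
  rw [intervalIntegral.integral_sub (by simp) (Continuous.intervalIntegrable (by fun_prop) _ _),
    intervalIntegral.integral_div, integral_id]
  simp
  field_simp
  ring

theorem kk_nonneg (l u : ℝ) (hl : 0 < l) : 0 ≤ kk l u := by
  rcases eq_or_ne u 0 with rfl | hu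
  · rw [kk]; simp only [mul_zero, Real.cos_zero, mul_one]
    rw [int_hat l hl]; positivity
  · rw [kk_eq l u hl hu]
    have := Real.cos_le_one (l * u)
    have : 0 ≤ 1 - Real.cos (l * u) := by linarith
    positivity

theorem kk_mul_sq (l u : ℝ) (hl : 0 < l) : kk l u * u ^ 2 ≤ 4 / l := by
  rcases eq_or_ne u 0 with rfl | hu
  · simp; positivity
  · rw [kk_eq l u hl hu]
    have := Real.neg_one_le_cos (l * u)
    rw [show 2 * (1 - Real.cos (l * u)) / (l * u ^ 2) * u ^ 2 = 2 * (1 - Real.cos (l * u)) / l by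
      field_simp]
    gcongr
    linarith

theorem kk_le (l u : ℝ) (hl : 0 < l) : kk l u ≤ (2 * l + 4 / l) * (1 / (1 + u ^ 2)) := by
  rw [mul_one_div, le_div_iff₀ (by positivity)]
  nlinarith [kk_le_two l u hl, kk_mul_sq l u hl]

theorem kk_lower (l u : ℝ) (hl : 0 < l) (hu : |u| ≤ 1 / l) : l / 2 ≤ kk l u := by
  rw [kk]
  have : ∫ t in (0:ℝ)..l, (1 - t / l) * (1 / 2) ≤ ∫ t in (0:ℝ)..l, (1 - t / l) * Real.cos (t * u) := by
    refine intervalIntegral.integral_mono_on hl.le (Continuous.intervalIntegrable (by fun_prop) _ _)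
      (Continuous.intervalIntegrable (by fun_prop) _ _) fun t ht => ?_
    have h2 : t / l ≤ 1 := (div_le_one hl).2 ht.2
    have h3 := Real.one_sub_sq_div_two_le_cos (x := t * u)
    have h4 : |t * u| ≤ 1 := by
      rw [abs_mul, abs_of_nonneg ht.1]
      calc t * |u| ≤ l * (1 / l) := by gcongr; exact ht.2
        _ = 1 := by field_simp
    have h5 : (t * u) ^ 2 ≤ 1 := by
      rw [← sq_abs]; nlinarith [abs_nonneg (t * u)]
    have : 1 / 2 ≤ Real.cos (t * u) := by linarith
    exact mul_le_mul_of_nonneg_left this (by linarith)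
  rw [intervalIntegral.integral_mul_const, int_hat l hl] at this
  linarith

theorem sq_shift (u v : ℝ) (h : |u - v| ≤ 1) : 1 / (1 + u ^ 2) ≤ 3 * (1 / (1 + v ^ 2)) := by
  rw [mul_one_div, div_le_div_iff₀ (by positivity) (by positivity)]
  have h2 := abs_le.1 h
  nlinarith [sq_nonneg (2 * u - v), sq_nonneg (u - v)]

theorem int_sum_bound : Summable (fun j : ℤ => 1 / (1 + (j : ℝ) ^ 2)) := by
  have h : Summable (fun j : ℤ => 1 / (j : ℝ) ^ 2) := Real.summable_one_div_int_pow.2 (by norm_num)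
  refine (h.add (summable_of_hasFiniteSupport (f := fun j : ℤ => if j = 0 then (1:ℝ) else 0) ?_)).of_nonneg_of_le
    (fun j => by positivity) fun j => ?_
  · refine (Set.finite_singleton (0:ℤ)).subset fun j hj => ?_
    by_contra h
    simp at hj h
    exact h hj
  · rcases eq_or_ne j 0 with rfl | hj
    · simp
    · rw [if_neg hj, add_zero]
      have : (0:ℝ) < (j:ℝ) ^ 2 := by positivity
      gcongr
      linarith

/-- uniform Chebyshev-type bound -/
theorem cheb_sum (b : ℕ → ℝ) (hb : ∀ n, 0 ≤ b n) (C : ℝ)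
    (hC : ∀ x : ℝ, 1 ≤ x → ∑ n ∈ Finset.Ioc 0 ⌊x⌋₊, b n ≤ C * x) :
    ∃ C₁ : ℝ, 0 ≤ C₁ ∧ ∀ y : ℝ, Summable (fun n : ℕ => b n / n * (1 / (1 + (Real.log n - y) ^ 2))) ∧
      ∑' n : ℕ, b n / n * (1 / (1 + (Real.log n - y) ^ 2)) ≤ C₁ := by
  have hC0 : 0 ≤ C := by
    have := hC 1 le_rfl
    have h2 : 0 ≤ ∑ n ∈ Finset.Ioc 0 ⌊(1:ℝ)⌋₊, b n := Finset.sum_nonneg fun n _ => hb n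
    linarith
  set W := ∑' j : ℤ, 1 / (1 + (j : ℝ) ^ 2) with hW
  have hW0 : 0 ≤ W := tsum_nonneg fun j => by positivity
  -- block bound
  have hblock : ∀ (S : Finset ℕ) (j : ℤ), (∀ n ∈ S, n ≠ 0 ∧ ⌊Real.log n⌋ = j) →
      ∑ n ∈ S, b n / n ≤ C * Real.exp 1 := by
    intro S j hS
    rcases S.eq_empty_or_nonempty with rfl | ⟨n₀, hn₀⟩
    · simp; positivity
    have hj0 : 0 ≤ j := by
      rw [← (hS n₀ hn₀).2]
      exact Int.floor_nonneg.2 (Real.log_natCast_nonneg _)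
    have hlow : ∀ n ∈ S, Real.exp j ≤ n := by
      intro n hn
      obtain ⟨h0, h1⟩ := hS n hn
      rw [← Real.le_log_iff_exp_le (by positivity), ← h1]
      exact Int.floor_le _
    have hup : ∀ n ∈ S, (n : ℝ) ≤ Real.exp (j + 1) := by
      intro n hn
      obtain ⟨h0, h1⟩ := hS n hn
      rw [← Real.log_le_iff_le_exp (by positivity), ← h1]
      exact (Int.lt_floor_add_one _).le
    have hsub : S ⊆ Finset.Ioc 0 ⌊Real.exp (j + 1)⌋₊ := by
      intro n hn
      rw [Finset.mem_Ioc]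
      exact ⟨Nat.pos_of_ne_zero (hS n hn).1, Nat.le_floor (hup n hn)⟩
    have hj0' : (0:ℝ) ≤ j := by exact_mod_cast hj0
    calc ∑ n ∈ S, b n / n ≤ ∑ n ∈ S, b n / Real.exp j := by
          refine Finset.sum_le_sum fun n hn => ?_
          have := hb n
          gcongr
          exact hlow n hn
      _ = (∑ n ∈ S, b n) / Real.exp j := by rw [Finset.sum_div]
      _ ≤ (C * Real.exp (j + 1)) / Real.exp j := by
          gcongr
          refine (Finset.sum_le_sum_of_subset_of_nonneg hsub fun n _ _ => hb n).trans (hC _ ?_)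
          exact Real.one_le_exp (by linarith)
      _ = C * Real.exp 1 := by rw [Real.exp_add]; field_simp
  have hfin : ∀ (y : ℝ) (S : Finset ℕ), ∑ n ∈ S, b n / n * (1 / (1 + (Real.log n - y) ^ 2)) ≤
      C * Real.exp 1 * (9 * W) := by
    intro y S
    classical
    have hstep : ∀ n ∈ S, b n / n * (1 / (1 + (Real.log n - y) ^ 2)) ≤
        b n / n * (9 * (1 / (1 + ((⌊Real.log n⌋ - ⌊y⌋ : ℤ) : ℝ) ^ 2))) := by
      intro n _
      have := hb n
      gcongr
      refine (sq_shift _ (⌊Real.log n⌋ - y) ?_).trans ?_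
      · rw [sub_sub_sub_cancel_right, abs_le]
        constructor <;> linarith [Int.floor_le (Real.log n), Int.lt_floor_add_one (Real.log n)]
      · have := sq_shift (⌊Real.log n⌋ - y) ((⌊Real.log n⌋ - ⌊y⌋ : ℤ) : ℝ) (by
          push_cast
          rw [sub_sub_sub_cancel_left, abs_le]
          constructor <;> linarith [Int.floor_le y, Int.lt_floor_add_one y])
        linarith
    refine (Finset.sum_le_sum hstep).trans ?_
    have hS0 : ∑ n ∈ S, b n / n * (9 * (1 / (1 + ((⌊Real.log n⌋ - ⌊y⌋ : ℤ) : ℝ) ^ 2))) =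
        ∑ n ∈ S.filter (fun n => n ≠ 0), b n / n * (9 * (1 / (1 + ((⌊Real.log n⌋ - ⌊y⌋ : ℤ) : ℝ) ^ 2))) := by
      rw [Finset.sum_filter]
      refine Finset.sum_congr rfl fun n _ => ?_
      by_cases h : n = 0
      · simp [h]
      · simp [h]
    rw [hS0]
    set T := S.filter (fun n => n ≠ 0)
    rw [← Finset.sum_fiberwise_of_maps_to (s := T) (t := T.image (fun n : ℕ => ⌊Real.log n⌋ - ⌊y⌋))
      (g := fun n : ℕ => ⌊Real.log n⌋ - ⌊y⌋) (fun n hn => Finset.mem_image_of_mem _ hn)]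
    calc _ ≤ ∑ j ∈ T.image (fun n : ℕ => ⌊Real.log n⌋ - ⌊y⌋), C * Real.exp 1 * (9 * (1 / (1 + (j:ℝ) ^ 2))) := by
          refine Finset.sum_le_sum fun j _ => ?_
          have : ∀ n ∈ T.filter (fun n : ℕ => ⌊Real.log n⌋ - ⌊y⌋ = j),
              b n / n * (9 * (1 / (1 + ((⌊Real.log n⌋ - ⌊y⌋ : ℤ) : ℝ) ^ 2))) =
              b n / n * (9 * (1 / (1 + (j : ℝ) ^ 2))) := by
            intro n hn
            rw [(Finset.mem_filter.1 hn).2]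
          rw [Finset.sum_congr rfl this, ← Finset.sum_mul]
          gcongr
          refine hblock _ (j + ⌊y⌋) fun n hn => ?_
          obtain ⟨h1, h2⟩ := Finset.mem_filter.1 hn
          exact ⟨(Finset.mem_filter.1 h1).2, by omega⟩
      _ = C * Real.exp 1 * (9 * ∑ j ∈ T.image (fun n : ℕ => ⌊Real.log n⌋ - ⌊y⌋), (1 / (1 + (j:ℝ) ^ 2))) := by
          rw [Finset.mul_sum, Finset.mul_sum]
      _ ≤ C * Real.exp 1 * (9 * W) := by
          gcongr
          exact int_sum_bound.sum_le_tsum _ fun j _ => by positivity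
  refine ⟨C * Real.exp 1 * (9 * W), by positivity, fun y => ?_⟩
  have hnn : ∀ n : ℕ, 0 ≤ b n / n * (1 / (1 + (Real.log n - y) ^ 2)) := fun n => by
    have := hb n
    positivity
  exact ⟨summable_of_sum_le hnn (hfin y), Real.tsum_le_of_sum_le hnn (hfin y)⟩
end P7

section P8
open MeasureTheory Filter Topology Complex

theorem LSeries_re2 (a : ℕ → ℝ) (σ t y : ℝ) (h : LSeriesSummable (fun n => (a n : ℂ)) σ) :
    HasSum (fun n : ℕ => (if n = 0 then 0 else a n * (n : ℝ) ^ (-σ)) * Real.cos (t * (Real.log n - y)))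
      (cexp ((t * y : ℝ) * I) * LSeries (fun n => (a n : ℂ)) (σ + t * I)).re := by
  have h2 : LSeriesSummable (fun n => (a n : ℂ)) (σ + t * I) :=
    LSeriesSummable.of_re_le_re (by simp) h
  have h3 := hasSum_re (h2.hasSum.mul_left (cexp ((t * y : ℝ) * I)))
  refine h3.congr_fun ?_
  intro n
  rcases eq_or_ne n 0 with rfl | hn
  · simp
  · rw [LSeries.term_of_ne_zero hn, if_neg hn]
    have hn0 : (0:ℝ) < n := by positivity
    have : cexp ((t * y : ℝ) * I) * ((a n : ℂ) / (n : ℂ) ^ ((σ : ℂ) + t * I)) =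
        ((a n * (n:ℝ) ^ (-σ) : ℝ) : ℂ) * cexp (((-(t * (Real.log n - y)) : ℝ) : ℂ) * I) := by
      rw [div_eq_mul_inv, ← cpow_neg, neg_add, cpow_add _ _ (by exact_mod_cast hn)]
      push_cast
      rw [ofReal_cpow hn0.le, cpow_def_of_ne_zero (x := (n : ℂ)) (y := -(t * I)) (by exact_mod_cast hn)]
      rw [← natCast_log]
      push_cast
      rw [show -((t:ℂ) * (log n - y)) * I = t * y * I + log n * -(t * I) by ring, Complex.exp_add]
      ring
    rw [this, re_ofReal_mul, exp_ofReal_mul_I_re, Real.cos_neg]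

theorem fejer_identity (b c : ℕ → ℝ) (hbc : ∀ n, |b n| ≤ c n) (C : ℝ)
    (hC : ∀ x : ℝ, 1 ≤ x → ∑ n ∈ Finset.Ioc 0 ⌊x⌋₊, c n ≤ C * x)
    (hsum : ∀ σ : ℝ, 1 < σ → LSeriesSummable (fun n => (b n : ℂ)) σ)
    (G : ℂ → ℂ) (hG : ContinuousOn G {s | 1 ≤ s.re})
    (hLG : ∀ s : ℂ, 1 < s.re → LSeries (fun n => (b n : ℂ)) s = G s) (l : ℝ) (hl : 0 < l) (y : ℝ) :
    ∑' n : ℕ, b n / n * kk l (Real.log n - y) =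
      2 * ∫ t in (0:ℝ)..l, (1 - t / l) * (cexp ((t * y : ℝ) * I) * G (1 + t * I)).re := by
  have hc0 : ∀ n, 0 ≤ c n := fun n => (abs_nonneg _).trans (hbc n)
  obtain ⟨C₁, _, hC₁⟩ := cheb_sum c hc0 C hC
  have hA : ∀ σ : ℝ, 1 < σ →
      HasSum (fun n : ℕ => (if n = 0 then 0 else b n * (n : ℝ) ^ (-σ)) * kk l (Real.log n - y))
      (2 * ∫ t in (0:ℝ)..l, (1 - t / l) * (cexp ((t * y : ℝ) * I) * G (σ + t * I)).re) := by
    intro σ hσ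
    have hs := hsum σ hσ
    have hB : Summable (fun n : ℕ => |if n = 0 then 0 else b n * (n : ℝ) ^ (-σ)|) := by
      have h0 := (LSeries_re2 b σ 0 0 hs).summable.abs
      simpa using h0
    have h1 : HasSum (fun n : ℕ => ∫ t in (0:ℝ)..l,
        (1 - t / l) * ((if n = 0 then 0 else b n * (n : ℝ) ^ (-σ)) * Real.cos (t * (Real.log n - y))))
        (∫ t in (0:ℝ)..l, (1 - t / l) * (cexp ((t * y : ℝ) * I) * G (σ + t * I)).re) := by
      refine intervalIntegral.hasSum_integral_of_dominated_convergence
        (fun n _ => |if n = 0 then 0 else b n * (n : ℝ) ^ (-σ)|) ?_ ?_ ?_ ?_ ?_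
      · intro n
        refine Continuous.aestronglyMeasurable ?_
        fun_prop
      · intro n
        refine Eventually.of_forall fun t ht => ?_
        rw [Set.uIoc_of_le hl.le] at ht
        have h1 : 0 ≤ t / l := div_nonneg ht.1.le hl.le
        have h2 : t / l ≤ 1 := (div_le_one hl).2 ht.2
        rw [Real.norm_eq_abs, abs_mul, abs_mul, abs_of_nonneg (by linarith : 0 ≤ 1 - t / l)]
        have h3 := Real.abs_cos_le_one (t * (Real.log n - y))
        set B := |if n = 0 then 0 else b n * (n : ℝ) ^ (-σ)|
        have hB0 : 0 ≤ B := abs_nonneg _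
        calc (1 - t / l) * (B * |Real.cos (t * (Real.log n - y))|) ≤ 1 * (B * 1) := by
              gcongr
              linarith
          _ = B := by ring
      · exact Eventually.of_forall fun t _ => hB
      · exact intervalIntegrable_const
      · refine Eventually.of_forall fun t _ => ?_
        have := (LSeries_re2 b σ t y hs).mul_left (1 - t / l)
        rwa [hLG _ (by simpa using hσ)] at this
    refine (h1.mul_left 2).congr_fun fun n => ?_
    rw [kk]
    rw [← intervalIntegral.integral_const_mul, ← intervalIntegral.integral_const_mul,
      ← intervalIntegral.integral_const_mul]
    congr 1
    ext t
    ring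
  have hL : Tendsto (fun σ : ℝ => ∑' n : ℕ, (if n = 0 then 0 else b n * (n : ℝ) ^ (-σ)) *
      kk l (Real.log n - y)) (𝓝[>] 1) (𝓝 (∑' n : ℕ, b n / n * kk l (Real.log n - y))) := by
    refine tendsto_tsum_of_dominated_convergence
      (bound := fun n => (2 * l + 4 / l) * (c n / n * (1 / (1 + (Real.log n - y) ^ 2)))) ?_ ?_ ?_
    · exact (hC₁ y).1.mul_left _
    · intro n
      rcases eq_or_ne n 0 with rfl | hn
      · simp
      · simp only [if_neg hn]
        refine Tendsto.mul_const _ ?_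
        rw [div_eq_mul_inv, ← Real.rpow_neg_one]
        refine Tendsto.const_mul _ ?_
        have hcont : Continuous (fun σ : ℝ => (n : ℝ) ^ (-σ)) :=
          Continuous.rpow continuous_const continuous_neg (fun _ => Or.inl (by exact_mod_cast hn))
        exact (hcont.tendsto 1).mono_left nhdsWithin_le_nhds
    · filter_upwards [self_mem_nhdsWithin] with σ hσ n
      have hσ' : 1 < σ := hσ
      have hk0 := kk_nonneg l (Real.log n - y) hl
      have hk1 := kk_le l (Real.log n - y) hl
      rcases eq_or_ne n 0 with rfl | hn
      · simp
      · rw [if_neg hn, Real.norm_eq_abs, abs_mul, abs_mul, abs_of_nonneg hk0]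
        have hn1 : (1:ℝ) ≤ n := by exact_mod_cast Nat.one_le_iff_ne_zero.2 hn
        have h5 : |(n:ℝ) ^ (-σ)| ≤ (n:ℝ)⁻¹ := by
          rw [abs_of_nonneg (by positivity), ← Real.rpow_neg_one]
          exact Real.rpow_le_rpow_of_exponent_le hn1 (by linarith)
        calc |b n| * |(n:ℝ) ^ (-σ)| * kk l (Real.log n - y)
            ≤ c n * (n:ℝ)⁻¹ * ((2 * l + 4 / l) * (1 / (1 + (Real.log n - y) ^ 2))) := by
              have := hc0 n
              gcongr
              exact hbc n
          _ = _ := by ring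
  have hR : Tendsto (fun σ : ℝ => 2 * ∫ t in (0:ℝ)..l, (1 - t / l) *
      (cexp ((t * y : ℝ) * I) * G (σ + t * I)).re) (𝓝[>] 1)
      (𝓝 (2 * ∫ t in (0:ℝ)..l, (1 - t / l) * (cexp ((t * y : ℝ) * I) * G (1 + t * I)).re)) := by
    refine Tendsto.const_mul _ ?_
    have hcpt : IsCompact (Set.Icc (1:ℝ) 2 ×ℂ Set.Icc (0:ℝ) l) := isCompact_Icc.reProdIm isCompact_Icc
    obtain ⟨M, hM⟩ := hcpt.exists_bound_of_continuousOn (hG.mono fun s hs => hs.1.1)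
    refine intervalIntegral.tendsto_integral_filter_of_dominated_convergence (fun _ => M) ?_ ?_ ?_ ?_
    · filter_upwards [self_mem_nhdsWithin] with σ hσ
      have hσ' : 1 < σ := hσ
      have hGc : Continuous (fun t : ℝ => G (σ + t * I)) := by
        refine hG.comp_continuous (by fun_prop) fun t => ?_
        simp [hσ'.le]
      have hE : Continuous (fun t : ℝ => cexp ((t * y : ℝ) * I)) := by fun_prop
      have hE2 : Continuous (fun t : ℝ => 1 - t / l) := by fun_prop
      exact (hE2.mul (continuous_re.comp (hE.mul hGc))).aestronglyMeasurable
    · filter_upwards [Ioo_mem_nhdsGT (show (1:ℝ) < 2 by norm_num)] with σ hσ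
      refine Eventually.of_forall fun t ht => ?_
      rw [Set.uIoc_of_le hl.le] at ht
      have h1 : 0 ≤ t / l := div_nonneg ht.1.le hl.le
      have h2 : t / l ≤ 1 := (div_le_one hl).2 ht.2
      rw [Real.norm_eq_abs, abs_mul, abs_of_nonneg (by linarith : 0 ≤ 1 - t / l)]
      have h3 : |(cexp ((t * y : ℝ) * I) * G (σ + t * I)).re| ≤ M := by
        refine (abs_re_le_norm _).trans ?_
        rw [norm_mul, norm_exp_ofReal_mul_I, one_mul]
        refine hM _ ⟨?_, ?_⟩
        · simp [hσ.1.le, hσ.2.le]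
        · simp [ht.1.le, ht.2]
      have h4 := (abs_nonneg _).trans h3
      nlinarith [abs_nonneg (cexp ((t * y : ℝ) * I) * G (σ + t * I)).re]
    · exact intervalIntegrable_const
    · refine Eventually.of_forall fun t _ => ?_
      refine Tendsto.const_mul _ ?_
      refine (continuous_re.tendsto _).comp (Tendsto.const_mul _ ?_)
      have hc := hG (1 + t * I) (by simp)
      refine hc.tendsto.comp ?_
      refine tendsto_nhdsWithin_iff.2 ⟨?_, ?_⟩
      · have : Continuous (fun σ : ℝ => (σ : ℂ) + t * I) := by fun_prop
        have h := this.tendsto 1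
        rw [ofReal_one] at h
        exact h.mono_left nhdsWithin_le_nhds
      · filter_upwards [self_mem_nhdsWithin] with σ hσ
        have hσ' : 1 < σ := hσ
        simp [hσ'.le]
  refine tendsto_nhds_unique (hL.congr' ?_) hR
  filter_upwards [self_mem_nhdsWithin] with σ hσ
  exact (hA σ hσ).tsum_eq

theorem fejer_lim (b c : ℕ → ℝ) (hbc : ∀ n, |b n| ≤ c n) (C : ℝ)
    (hC : ∀ x : ℝ, 1 ≤ x → ∑ n ∈ Finset.Ioc 0 ⌊x⌋₊, c n ≤ C * x)
    (hsum : ∀ σ : ℝ, 1 < σ → LSeriesSummable (fun n => (b n : ℂ)) σ)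
    (G : ℂ → ℂ) (hG : ContinuousOn G {s | 1 ≤ s.re})
    (hLG : ∀ s : ℂ, 1 < s.re → LSeries (fun n => (b n : ℂ)) s = G s) (l : ℝ) (hl : 0 < l) :
    Tendsto (fun y => ∑' n : ℕ, b n / n * kk l (Real.log n - y)) atTop (𝓝 0) := by
  simp_rw [fejer_identity b c hbc C hC hsum G hG hLG l hl]
  suffices hmain : Tendsto (fun y : ℝ => ∫ t in (0:ℝ)..l,
      (1 - t / l) * (cexp ((t * y : ℝ) * I) * G (1 + t * I)).re) atTop (𝓝 (0:ℂ).re) by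
    simpa using hmain.const_mul 2
  set f : ℝ → ℂ := (Set.Ioc 0 l).indicator (fun t => ((1 - t / l : ℝ) : ℂ) * G (1 + t * I)) with hf
  have hRL := Real.tendsto_integral_exp_smul_cocompact f
  have hw : Tendsto (fun y : ℝ => -(y / (2 * Real.pi))) atTop (cocompact ℝ) := by
    have h1 : Tendsto (fun y : ℝ => -(y / (2 * Real.pi))) atTop atBot :=
      tendsto_neg_atTop_atBot.comp (tendsto_id.atTop_div_const (by positivity))
    exact h1.mono_right atBot_le_cocompact
  have h2 := (continuous_re.tendsto _).comp (hRL.comp hw)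
  refine h2.congr fun y => ?_
  simp only [Function.comp]
  have hGc : Continuous (fun t : ℝ => G (1 + t * I)) := by
    refine hG.comp_continuous (by fun_prop) fun t => ?_
    simp
  have h3 : ∀ t : ℝ, (Real.fourierChar (-(t * -(y / (2 * Real.pi))))) • f t =
      (Set.Ioc 0 l).indicator (fun t : ℝ => cexp ((t * y : ℝ) * I) * (((1 - t / l : ℝ) : ℂ) * G (1 + t * I))) t := by
    intro t
    rw [Circle.smul_def, Real.fourierChar_apply, hf]
    by_cases ht : t ∈ Set.Ioc 0 l
    · simp only [Set.indicator_of_mem ht, smul_eq_mul]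
      congr 3
      push_cast
      have : (Real.pi : ℂ) ≠ 0 := by exact_mod_cast Real.pi_ne_zero
      field_simp
    · simp only [Set.indicator_of_notMem ht, smul_zero]
  simp_rw [h3]
  rw [integral_indicator measurableSet_Ioc, ← intervalIntegral.integral_of_le hl.le]
  have hi : IntervalIntegrable (fun t : ℝ => cexp ((t * y : ℝ) * I) * (((1 - t / l : ℝ) : ℂ) * G (1 + t * I)))
      volume 0 l := by
    have hE : Continuous (fun t : ℝ => cexp ((t * y : ℝ) * I)) := by fun_prop
    have hE2 : Continuous (fun t : ℝ => ((1 - t / l : ℝ) : ℂ)) := by fun_prop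
    exact (hE.mul (hE2.mul hGc)).intervalIntegrable _ _
  have h4 := reCLM.intervalIntegral_comp_comm hi
  simp only [reCLM_apply] at h4
  rw [← h4]
  congr 1
  ext t
  rw [← re_ofReal_mul]
  congr 1
  ring
end P8

section P9
open MeasureTheory Filter Topology Complex

theorem one_cheb (x : ℝ) (hx : 1 ≤ x) : ∑ n ∈ Finset.Ioc 0 ⌊x⌋₊, (1:ℝ) ≤ 1 * x := by
  simp only [Finset.sum_const, Nat.card_Ioc, nsmul_eq_mul, mul_one, one_mul, tsub_zero]
  exact Nat.floor_le (by linarith)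

theorem lam_cheb : ∃ C : ℝ, ∀ x : ℝ, 1 ≤ x →
    ∑ n ∈ Finset.Ioc 0 ⌊x⌋₊, ArithmeticFunction.vonMangoldt n ≤ C * x :=
  ⟨_, fun x hx => Chebyshev.psi_le_const_mul_self (by linarith)⟩

theorem kk_summable (b c : ℕ → ℝ) (hbc : ∀ n, |b n| ≤ c n) (C : ℝ)
    (hC : ∀ x : ℝ, 1 ≤ x → ∑ n ∈ Finset.Ioc 0 ⌊x⌋₊, c n ≤ C * x) (l : ℝ) (hl : 0 < l) (y : ℝ) :
    Summable (fun n : ℕ => b n / n * kk l (Real.log n - y)) := by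
  have hc0 : ∀ n, 0 ≤ c n := fun n => (abs_nonneg _).trans (hbc n)
  obtain ⟨C₁, _, hC₁⟩ := cheb_sum c hc0 C hC
  refine Summable.of_norm_bounded ((hC₁ y).1.mul_left (2 * l + 4 / l)) fun n => ?_
  have hk0 := kk_nonneg l (Real.log n - y) hl
  have hk1 := kk_le l (Real.log n - y) hl
  rw [Real.norm_eq_abs, abs_mul, abs_div, abs_of_nonneg hk0, Nat.abs_cast]
  calc |b n| / n * kk l (Real.log n - y)
      ≤ c n / n * ((2 * l + 4 / l) * (1 / (1 + (Real.log n - y) ^ 2))) := by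
        have := hc0 n
        gcongr
        exact hbc n
    _ = _ := by ring

theorem harmonic_lower (l : ℝ) (hl : 1 ≤ l) :
    ∀ᶠ y : ℝ in atTop, 1 / 8 ≤ ∑' n : ℕ, (1:ℝ) / n * kk l (Real.log n - y) := by
  have hl0 : 0 < l := by linarith
  have hev : ∀ᶠ y : ℝ in atTop, Real.exp (-y) ≤ 1 / (4 * l) :=
    (Real.tendsto_exp_neg_atTop_nhds_zero.eventually_le_const (by positivity))
  filter_upwards [hev, eventually_ge_atTop 0] with y hy hy0
  have hsum := kk_summable (fun _ => 1) (fun _ => 1) (by simp) 1 one_cheb l hl0 y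
  set S := Finset.Ioc ⌊Real.exp y⌋₊ ⌊Real.exp (y + 1 / l)⌋₊ with hS
  refine le_trans ?_ (hsum.sum_le_tsum S fun n _ => by
    have := kk_nonneg l (Real.log n - y) hl0
    positivity)
  have hterm : ∀ n ∈ S, Real.exp (-(y + 1 / l)) * (l / 2) ≤ (1:ℝ) / n * kk l (Real.log n - y) := by
    intro n hn
    rw [hS, Finset.mem_Ioc] at hn
    have h1 : Real.exp y < n := (Nat.floor_lt (Real.exp_pos _).le).1 hn.1
    have h2 : (n:ℝ) ≤ Real.exp (y + 1 / l) := (Nat.le_floor_iff (Real.exp_pos _).le).1 hn.2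
    have hn0 : (0:ℝ) < n := (Real.exp_pos _).trans h1
    have h3 : y < Real.log n := (Real.lt_log_iff_exp_lt hn0).2 h1
    have h4 : Real.log n ≤ y + 1 / l := (Real.log_le_iff_le_exp hn0).2 h2
    have h5 : l / 2 ≤ kk l (Real.log n - y) := by
      refine kk_lower l _ hl0 ?_
      rw [abs_of_pos (by linarith)]
      linarith
    have h6 : Real.exp (-(y + 1 / l)) ≤ 1 / n := by
      rw [Real.exp_neg, inv_eq_one_div]
      gcongr
    gcongr
  refine le_trans ?_ (Finset.sum_le_sum hterm)
  rw [Finset.sum_const, nsmul_eq_mul, hS, Nat.card_Ioc]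
  have hle : ⌊Real.exp y⌋₊ ≤ ⌊Real.exp (y + 1 / l)⌋₊ := by
    refine Nat.floor_le_floor (Real.exp_le_exp.2 ?_)
    have : 0 ≤ 1 / l := by positivity
    linarith
  rw [Nat.cast_sub hle]
  have h1 := Nat.floor_le (Real.exp_pos y).le
  have h2 := Nat.lt_floor_add_one (Real.exp (y + 1 / l))
  set N := (⌊Real.exp (y + 1 / l)⌋₊ : ℝ) - ⌊Real.exp y⌋₊
  have h3 : Real.exp (y + 1 / l) - Real.exp y - 1 ≤ N := by simp only [N]; linarith
  have h4 : (Real.exp (y + 1 / l) - Real.exp y - 1) * (Real.exp (-(y + 1 / l)) * (l / 2)) ≤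
      N * (Real.exp (-(y + 1 / l)) * (l / 2)) := by gcongr
  refine le_trans ?_ h4
  set v := 1 / l with hv
  have hv1 : v ≤ 1 := by rw [hv, div_le_one hl0]; exact hl
  have hv0 : 0 < v := by positivity
  have e1 : (Real.exp (y + v) - Real.exp y - 1) * (Real.exp (-(y + v)) * (l / 2)) =
      (1 - Real.exp (-v) - Real.exp (-y) * Real.exp (-v)) * (l / 2) := by
    rw [neg_add, Real.exp_add, Real.exp_add, Real.exp_neg y, Real.exp_neg v]
    field_simp
  rw [e1]
  have h5 : Real.exp (-v) ≤ 1 - v / 2 := by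
    have := Real.add_one_le_exp v
    rw [Real.exp_neg]
    rw [inv_le_comm₀ (Real.exp_pos v) (by linarith)]
    refine le_trans ?_ this
    rw [inv_le_iff_one_le_mul₀ (by linarith)]
    nlinarith
  have h6 : Real.exp (-y) * Real.exp (-v) ≤ v / 4 := by
    have : Real.exp (-v) ≤ 1 := Real.exp_le_one_iff.2 (by linarith)
    calc Real.exp (-y) * Real.exp (-v) ≤ 1 / (4 * l) * 1 := by gcongr
      _ = v / 4 := by rw [hv]; field_simp
  have h7 : v / 4 ≤ 1 - Real.exp (-v) - Real.exp (-y) * Real.exp (-v) := by linarith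
  calc (1:ℝ) / 8 = v / 4 * (l / 2) := by rw [hv]; field_simp; norm_num
    _ ≤ _ := by gcongr

theorem one_ext : (∀ s : ℂ, 1 < s.re → LSeriesSummable (fun _ => ((1:ℝ) : ℂ)) s) ∧
    ∃ G : ℂ → ℂ, ContinuousOn G {s | 1 ≤ s.re} ∧
      ∀ s : ℂ, 1 < s.re → LSeries (fun _ => ((1:ℝ) : ℂ)) s = G s + 1 / (s - 1) := by
  obtain ⟨h1, H, hH, hH1, hH2⟩ := zeta_cont (fun _ => 1) (fun _ => zero_le_one) 1 1 1 zero_lt_one le_rfl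
    zero_le_one (by
      intro t ht
      simp only [Finset.sum_const, Nat.card_Icc, nsmul_eq_mul, mul_one, one_mul, sub_self,
        Real.rpow_zero, Nat.add_sub_cancel]
      rw [abs_le]
      constructor <;> linarith [Nat.floor_le (by linarith : 0 ≤ t), Nat.lt_floor_add_one t])
  refine ⟨h1, dslope H 1, ?_, ?_⟩
  · have hU : {s : ℂ | 1 - 1 < s.re} ∈ 𝓝 (1:ℂ) :=
      (isOpen_lt continuous_const continuous_re).mem_nhds (by simp)
    have hc : ContinuousOn (dslope H 1) {s : ℂ | 1 - (1:ℝ) < s.re} := by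
      rw [continuousOn_dslope (by simpa using hU)]
      refine ⟨hH.continuousOn, ?_⟩
      exact hH.differentiableAt (by simpa using hU)
    refine hc.mono fun s hs => ?_
    simp only [Set.mem_ofPred_eq] at hs ⊢
    linarith
  · intro s hs
    have hs1 : s ≠ 1 := by
      rintro rfl
      simp at hs
    have hs2 : s - 1 ≠ 0 := sub_ne_zero.2 hs1
    rw [dslope_of_ne _ hs1, slope_def_field, hH2 s hs, hH1]
    push_cast
    field_simp
    ring

theorem nonprime_small (l : ℝ) (hl : 0 < l) : Tendsto (fun y : ℝ => ∑' n : ℕ,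
    ((if n.Prime then 0 else ArithmeticFunction.vonMangoldt n) / n) * kk l (Real.log n - y)) atTop (𝓝 0) := by
  have hs : Summable fun n : ℕ ↦ (if n.Prime then 0 else ArithmeticFunction.vonMangoldt n) / n := by
    have := ArithmeticFunction.vonMangoldt.summable_residueClass_non_primes_div (q := 1) 0
    refine this.congr fun n => ?_
    simp [ArithmeticFunction.vonMangoldt.residueClass, Subsingleton.elim ((n:ℕ) : ZMod 1) 0]
  have hnn : ∀ n : ℕ, 0 ≤ (if n.Prime then 0 else ArithmeticFunction.vonMangoldt n) / (n:ℝ) := by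
    intro n
    have := ArithmeticFunction.vonMangoldt_nonneg (n := n)
    split_ifs <;> positivity
  suffices h : Tendsto (fun y : ℝ => ∑' n : ℕ,
      ((if n.Prime then 0 else ArithmeticFunction.vonMangoldt n) / n) * kk l (Real.log n - y)) atTop
      (𝓝 (∑' _ : ℕ, (0:ℝ))) by
    rwa [tsum_zero] at h
  refine tendsto_tsum_of_dominated_convergence (hs.mul_right (2 * l)) ?_ ?_
  · intro n
    have h1 : Tendsto (fun y : ℝ => (2 * l + 4 / l) * (1 / (1 + (Real.log n - y) ^ 2))) atTop (𝓝 0) := by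
      suffices h : Tendsto (fun y : ℝ => 1 / (1 + (Real.log n - y) ^ 2)) atTop (𝓝 0) by
        have h2 := h.const_mul (2 * l + 4 / l)
        rwa [mul_zero] at h2
      simp_rw [one_div]
      refine tendsto_inv_atTop_zero.comp ?_
      refine tendsto_atTop_add_const_left _ _ ?_
      have : Tendsto (fun y : ℝ => y - Real.log n) atTop atTop := tendsto_atTop_add_const_right _ _ tendsto_id
      refine ((tendsto_pow_atTop (two_ne_zero)).comp this).congr fun y => ?_
      simp only [Function.comp]; ring
    have h3 := (squeeze_zero (fun y => kk_nonneg l _ hl) (fun y => kk_le l _ hl) h1).const_mul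
      ((if n.Prime then 0 else ArithmeticFunction.vonMangoldt n) / (n:ℝ))
    rwa [mul_zero] at h3
  · refine Eventually.of_forall fun y n => ?_
    have := kk_nonneg l (Real.log n - y) hl
    rw [Real.norm_of_nonneg (mul_nonneg (hnn n) this)]
    exact mul_le_mul_of_nonneg_left (kk_le_two l _ hl) (hnn n)
end P9

section P10
open MeasureTheory Filter Topology Complex
open scoped NumberField

theorem window_b (K L : Type) [Field K] [NumberField K] [Field L] [NumberField L] (l : ℝ) (hl : 0 < l) :
    Tendsto (fun y : ℝ => ∑' n : ℕ, (vm K n - vm ℚ n - vm L n / Module.finrank ℚ L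
      + 1 / Module.finrank ℚ L) / n * kk l (Real.log n - y)) atTop (𝓝 0) ∧
    (∀ y, Summable (fun n : ℕ => (vm K n - vm ℚ n - vm L n / Module.finrank ℚ L
      + 1 / Module.finrank ℚ L) / n * kk l (Real.log n - y))) := by
  set m : ℕ := Module.finrank ℚ L with hm
  set k : ℕ := Module.finrank ℚ K with hk
  have hm0 : (1:ℝ) ≤ m := by
    have : 0 < m := Module.finrank_pos
    exact_mod_cast this
  have hmC : (m:ℂ) ≠ 0 := by
    have : 0 < m := Module.finrank_pos
    exact_mod_cast this.ne'
  set b : ℕ → ℝ := fun n => vm K n - vm ℚ n - vm L n / m + 1 / m with hb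
  set c : ℕ → ℝ := fun n => (k + 2) * (ArithmeticFunction.vonMangoldt n + 1) with hc
  have hbc : ∀ n, |b n| ≤ c n := by
    intro n
    have h1 := vm_nonneg K n
    have h2 := vm_nonneg ℚ n
    have h3 := vm_nonneg L n
    have h4 := vm_le K n
    have h5 := vm_le ℚ n
    have h6 := vm_le L n
    rw [← hk] at h4
    rw [← hm] at h6
    rw [Module.finrank_self, Nat.cast_one, one_mul] at h5
    have h7 := ArithmeticFunction.vonMangoldt_nonneg (n := n)
    have h8 : vm L n / m ≤ ArithmeticFunction.vonMangoldt n := by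
      rw [div_le_iff₀ (by linarith), mul_comm]; exact h6
    have h9 : 0 ≤ vm L n / m := by positivity
    have h10 : 1 / (m:ℝ) ≤ 1 := by rw [div_le_one (by linarith)]; exact hm0
    have h11 : 0 ≤ 1 / (m:ℝ) := by positivity
    have h12 : (0:ℝ) ≤ k := by positivity
    simp only [hb, hc]
    rw [abs_le]
    constructor <;> nlinarith
  obtain ⟨C0, hC0⟩ := lam_cheb
  have hC : ∀ x : ℝ, 1 ≤ x → ∑ n ∈ Finset.Ioc 0 ⌊x⌋₊, c n ≤ ((k + 2) * (C0 + 1)) * x := by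
    intro x hx
    simp only [hc]
    rw [← Finset.mul_sum, Finset.sum_add_distrib, mul_assoc, add_mul C0]
    have h1 := hC0 x hx
    have h2 := one_cheb x hx
    exact mul_le_mul_of_nonneg_left (add_le_add h1 h2) (by positivity)
  obtain ⟨h1s, G1, hG1, hG1'⟩ := one_ext
  obtain ⟨GK, hGK, hGK'⟩ := vm_ext K
  obtain ⟨GQ, hGQ, hGQ'⟩ := vm_ext ℚ
  obtain ⟨GLL, hGL, hGL'⟩ := vm_ext L
  have hbeq : (fun n => (b n : ℂ)) = ((fun n => (vm K n : ℂ)) - (fun n => (vm ℚ n : ℂ))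
      - (1 / (m:ℂ)) • (fun n => (vm L n : ℂ))) + (1 / (m:ℂ)) • (fun _ => ((1:ℝ) : ℂ)) := by
    funext n
    simp only [hb, Pi.add_apply, Pi.sub_apply, Pi.smul_apply, smul_eq_mul]
    push_cast
    ring
  have hsumm : ∀ s : ℂ, 1 < s.re → LSeriesSummable (fun n => (b n : ℂ)) s := by
    intro s hs
    rw [hbeq]
    exact (((vm_summable K s hs).sub (vm_summable ℚ s hs)).sub ((vm_summable L s hs).smul _)).add
      ((h1s s hs).smul _)
  refine ⟨?_, ?_⟩
  · refine fejer_lim b c hbc _ hC ?_ (fun s => GK s - GQ s - (1 / (m:ℂ)) * GLL s + (1 / (m:ℂ)) * G1 s)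
      ?_ ?_ l hl
    · intro σ hσ
      exact hsumm σ (by simpa using hσ)
    · exact ((hGK.sub hGQ).sub (continuousOn_const.mul hGL)).add (continuousOn_const.mul hG1)
    · intro s hs
      rw [hbeq, LSeries_add ((((vm_summable K s hs).sub (vm_summable ℚ s hs)).sub
        ((vm_summable L s hs).smul _))) ((h1s s hs).smul _), LSeries_sub ((vm_summable K s hs).sub
        (vm_summable ℚ s hs)) ((vm_summable L s hs).smul _), LSeries_sub (vm_summable K s hs)
        (vm_summable ℚ s hs), LSeries_smul, LSeries_smul, hGK' s hs, hGQ' s hs, hGL' s hs, hG1' s hs]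
      ring
  · intro y
    exact kk_summable b c hbc _ hC l hl y

theorem window (K L : Type) [Field K] [NumberField K] [Field L] [NumberField L]
    (hyp : ∃ p0 : ℕ, ∀ p : ℕ, p.Prime → p0 < p → 1 ≤ idealCount L p → 2 ≤ idealCount K p) :
    ∃ X : ℝ, ∀ x : ℝ, X ≤ x → ∃ p : ℕ, p.Prime ∧ x / 3 < p ∧ p < x / 2 ∧ idealCount K p = 0 := by
  obtain ⟨p0, hp0⟩ := hyp
  set m : ℕ := Module.finrank ℚ L with hm
  have hm0 : (1:ℝ) ≤ m := by
    have : 0 < m := Module.finrank_pos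
    exact_mod_cast this
  obtain ⟨C0, hC0⟩ := lam_cheb
  obtain ⟨C₁, hC₁0, hC₁⟩ := cheb_sum _ (fun n => ArithmeticFunction.vonMangoldt_nonneg (n := n)) C0 hC0
  set η : ℝ := (Real.log 3 - Real.log 2) / 2 with hη
  have hη0 : 0 < η := by
    have := Real.log_lt_log (by norm_num : (0:ℝ) < 2) (by norm_num : (2:ℝ) < 3)
    rw [hη]; linarith
  set A : ℝ := 8 * (1 + 1 / η ^ 2) * C₁ with hA
  have hA0 : 0 ≤ A := by positivity
  set l : ℝ := 32 * m * A + 1 with hldef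
  have hl1 : 1 ≤ l := by rw [hldef]; nlinarith
  have hl : 0 < l := by linarith
  have hAl : A / l ≤ 1 / (32 * m) := by
    rw [div_le_div_iff₀ hl (by positivity), hldef]
    nlinarith
  have hε : (0:ℝ) < 1 / (32 * m) := by positivity
  obtain ⟨hT, hS⟩ := window_b K L l hl
  rw [← hm] at hT hS
  have hNP := nonprime_small l hl
  have ev : ∀ᶠ y : ℝ in atTop, _ := ((hT.eventually_lt_const hε).and
    (((hNP.eventually_lt_const (by positivity : (0:ℝ) < 1 / (64 * m))).and (harmonic_lower l hl1))))
  have hyt : Tendsto (fun x : ℝ => Real.log x - (Real.log 2 + Real.log 3) / 2) atTop atTop :=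
    tendsto_atTop_add_const_right _ _ Real.tendsto_log_atTop
  have ev2 := (hyt.eventually ev).and (eventually_ge_atTop (3 * (p0:ℝ) + 1))
  obtain ⟨X, hX⟩ := eventually_atTop.1 ev2
  refine ⟨X, fun x hx => ?_⟩
  obtain ⟨⟨hb1, hb2, hb3⟩, hx0⟩ := hX x hx
  by_contra hcon
  push Not at hcon
  set y : ℝ := Real.log x - (Real.log 2 + Real.log 3) / 2 with hy
  have hxpos : 0 < x := by
    have : (0:ℝ) ≤ p0 := by positivity
    linarith
  set h0 : ℕ → ℝ := fun n => vm K n - vm ℚ n - vm L n / m with hh0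
  have hlow : ∀ n, -2 * ArithmeticFunction.vonMangoldt n ≤ h0 n := by
    intro n
    have h1 := vm_nonneg K n
    have h5 := vm_le ℚ n
    have h6 := vm_le L n
    rw [← hm] at h6
    rw [Module.finrank_self, Nat.cast_one, one_mul] at h5
    have h8 : vm L n / m ≤ ArithmeticFunction.vonMangoldt n := by
      rw [div_le_iff₀ (by linarith), mul_comm]; exact h6
    simp only [hh0]
    linarith
  have hprime : ∀ n : ℕ, n.Prime → |Real.log n - y| < η → 0 ≤ h0 n := by
    intro p hp hpy
    have hpp : (0:ℝ) < p := by exact_mod_cast hp.pos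
    have h5 := vm_le ℚ p
    have h6 := vm_le L p
    rw [← hm] at h6
    rw [Module.finrank_self, Nat.cast_one, one_mul] at h5
    have h8 : vm L p / m ≤ ArithmeticFunction.vonMangoldt p := by
      rw [div_le_iff₀ (by linarith), mul_comm]; exact h6
    rw [ArithmeticFunction.vonMangoldt_apply_prime hp] at h5 h8
    rw [abs_lt, hy, hη] at hpy
    have hx3 : x / 3 < p := by
      rw [← Real.log_lt_log_iff (by positivity) hpp, Real.log_div hxpos.ne' (by norm_num)]
      linarith
    have hx2 : p < x / 2 := by
      rw [← Real.log_lt_log_iff hpp (by positivity), Real.log_div hxpos.ne' (by norm_num)]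
      linarith
    have hK := Nat.one_le_iff_ne_zero.2 (hcon p hp hx3 hx2)
    have hpp0 : p0 < p := by
      have : (p0:ℝ) < p := by linarith
      exact_mod_cast this
    have hlog : 0 ≤ Real.log p := Real.log_natCast_nonneg p
    simp only [hh0]
    rw [vm_prime K p hp]
    by_cases hL : 1 ≤ idealCount L p
    · have h2 : (2:ℝ) ≤ idealCount K p := by exact_mod_cast hp0 p hp hpp0 hL
      nlinarith
    · have h2 : (1:ℝ) ≤ idealCount K p := by exact_mod_cast hK
      have h3 : idealCount L p = 0 := by omega
      rw [vm_prime L p hp, h3]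
      simp only [Nat.cast_zero, zero_mul, zero_div, sub_zero]
      nlinarith
  -- pointwise bound
  set E1 : ℕ → ℝ := fun n => ArithmeticFunction.vonMangoldt n / n * (1 / (1 + (Real.log n - y) ^ 2)) with hE1
  set E2 : ℕ → ℝ := fun n => ((if n.Prime then 0 else ArithmeticFunction.vonMangoldt n) / n) *
    kk l (Real.log n - y) with hE2
  have hpt : ∀ n : ℕ, -(8 / l * (1 + 1 / η ^ 2)) * E1 n - 2 * E2 n ≤ h0 n / n * kk l (Real.log n - y) := by
    intro n
    have hk0 := kk_nonneg l (Real.log n - y) hl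
    have hL0 := ArithmeticFunction.vonMangoldt_nonneg (n := n)
    have hE10 : 0 ≤ E1 n := by simp only [hE1]; positivity
    have hE20 : 0 ≤ E2 n := by
      simp only [hE2]
      split_ifs
      · simp
      · positivity
    have hD : 0 ≤ 8 / l * (1 + 1 / η ^ 2) := by positivity
    have hbase : -2 * (ArithmeticFunction.vonMangoldt n / n * kk l (Real.log n - y)) ≤
        h0 n / n * kk l (Real.log n - y) := by
      rw [← mul_assoc, ← mul_div_assoc]
      have := hlow n
      gcongr
    rcases le_or_gt η |Real.log n - y| with hu | hu
    · have hsq := kk_mul_sq l (Real.log n - y) hl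
      set u := Real.log n - y with hudef
      have hu2 : η ^ 2 ≤ u ^ 2 := by rw [← sq_abs u]; gcongr
      have hu0 : 0 < u ^ 2 := lt_of_lt_of_le (by positivity) hu2
      have hkk : kk l u ≤ (4 / l) * ((1 + 1 / η ^ 2) * (1 / (1 + u ^ 2))) := by
        have e1 : 1 ≤ u ^ 2 * ((1 + 1 / η ^ 2) * (1 / (1 + u ^ 2))) := by
          rw [mul_one_div, ← mul_div_assoc, le_div_iff₀ (by positivity)]
          have : 1 ≤ u ^ 2 * (1 / η ^ 2) := by
            rw [mul_one_div, le_div_iff₀ (by positivity)]; linarith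
          linarith
        calc kk l u = kk l u * 1 := by ring
          _ ≤ kk l u * (u ^ 2 * ((1 + 1 / η ^ 2) * (1 / (1 + u ^ 2)))) := by gcongr
          _ = (kk l u * u ^ 2) * ((1 + 1 / η ^ 2) * (1 / (1 + u ^ 2))) := by ring
          _ ≤ _ := by gcongr
      have : ArithmeticFunction.vonMangoldt n / n * kk l u ≤
          ArithmeticFunction.vonMangoldt n / n * ((4 / l) * ((1 + 1 / η ^ 2) * (1 / (1 + u ^ 2)))) := by
        gcongr
      have e3 : (8 / l * (1 + 1 / η ^ 2)) * E1 n = 2 * (ArithmeticFunction.vonMangoldt n / n *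
          ((4 / l) * ((1 + 1 / η ^ 2) * (1 / (1 + u ^ 2))))) := by
        simp only [hE1]; ring
      linarith
    · have hDE := mul_nonneg hD hE10
      by_cases hp : n.Prime
      · have h1 := hprime n hp hu
        have : 0 ≤ h0 n / n * kk l (Real.log n - y) := by positivity
        linarith
      · have : E2 n = ArithmeticFunction.vonMangoldt n / n * kk l (Real.log n - y) := by
          simp only [hE2, if_neg hp]
        rw [this]
        linarith
  obtain ⟨hE1s, hE1b⟩ := hC₁ y
  have hE2s : Summable E2 := by
    have := kk_summable (fun n => if n.Prime then 0 else ArithmeticFunction.vonMangoldt n)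
      (fun n => ArithmeticFunction.vonMangoldt n) (by
        intro n
        have := ArithmeticFunction.vonMangoldt_nonneg (n := n)
        split_ifs
        · simp [this]
        · rw [abs_of_nonneg this]) C0 hC0 l hl y
    exact this
  have hHs := kk_summable (fun _ => 1) (fun _ => 1) (by simp) 1 one_cheb l hl y
  have hh0eq : (fun n : ℕ => h0 n / n * kk l (Real.log n - y)) = fun n : ℕ =>
      (vm K n - vm ℚ n - vm L n / m + 1 / m) / n * kk l (Real.log n - y) -
        1 / m * ((1:ℝ) / n * kk l (Real.log n - y)) := by
    funext n
    simp only [hh0]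
    ring
  have hh0s : Summable (fun n : ℕ => h0 n / n * kk l (Real.log n - y)) := by
    rw [hh0eq]
    exact (hS y).sub (hHs.mul_left _)
  have hle := Summable.tsum_le_tsum hpt ((hE1s.mul_left _).sub (hE2s.mul_left _)) hh0s
  rw [hh0eq, (hS y).tsum_sub (hHs.mul_left _), (hE1s.mul_left _).tsum_sub (hE2s.mul_left _),
    tsum_mul_left, tsum_mul_left, tsum_mul_left] at hle
  have hf1 : (8 / l * (1 + 1 / η ^ 2)) * ∑' n, E1 n ≤ 1 / (32 * m) := by
    refine le_trans ?_ hAl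
    calc (8 / l * (1 + 1 / η ^ 2)) * ∑' n, E1 n ≤ (8 / l * (1 + 1 / η ^ 2)) * C₁ := by gcongr
      _ = A / l := by rw [hA]; ring
  have hf2 : 1 / (m:ℝ) * (1 / 8) ≤ 1 / m * ∑' n : ℕ, (1:ℝ) / n * kk l (Real.log n - y) := by gcongr
  have e1 : 1 / (m:ℝ) * (1 / 8) = 4 * (1 / (32 * m)) := by field_simp; norm_num
  have e2 : 1 / (64 * (m:ℝ)) = (1 / (32 * m)) / 2 := by field_simp; norm_num
  rw [e2] at hb2
  rw [e1] at hf2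
  linarith
end P10

section P11
open Polynomial

theorem homog_not_unit (q : MvPolynomial (Fin 2) ℚ) (n : ℕ) (hn : 1 ≤ n) (hq : q.IsHomogeneous n) :
    ¬ IsUnit q := by
  intro h
  have h1 := h.map (MvPolynomial.constantCoeff (R := ℚ) (σ := Fin 2))
  rw [MvPolynomial.constantCoeff_eq, hq.coeff_eq_zero (by simp; omega)] at h1
  simp at h1

theorem form_poly (f : MvPolynomial (Fin 2) ℚ) (d : ℕ) (hd : 2 ≤ d) (hirr : Irreducible f)
    (hhom : f.IsHomogeneous d) :
    ∃ g : ℚ[X], Irreducible g ∧ g.natDegree = d ∧ g.homogenize d = f := by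
  set g : ℚ[X] := MvPolynomial.aeval ![X, 1] f with hg
  have hgf : g.homogenize d = f := homogenize_eq_of_isHomogeneous hhom rfl
  have hgd : g.natDegree ≤ d := by
    rw [hg, f.as_sum, map_sum]
    refine natDegree_sum_le_of_forall_le _ _ fun m hm => ?_
    have hw := hhom (by simpa using hm : MvPolynomial.coeff m f ≠ 0)
    rw [MvPolynomial.aeval_monomial]
    simp only [Finsupp.prod_fintype, Fin.prod_univ_two, Matrix.cons_val_zero, Matrix.cons_val_one,
      one_pow, mul_one, pow_zero, implies_true, ← C_eq_algebraMap]
    refine (natDegree_C_mul_X_pow_le _ _).trans ?_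
    rw [← hw]
    simp [Finsupp.weight_apply, Finsupp.sum_fintype, Fin.sum_univ_two]
  have hgd2 : g.natDegree = d := by
    by_contra hne
    have h1 : g.natDegree ≤ d - 1 := by omega
    have h2 := homogenize_mul g 1 (m := d - 1) (n := 1) h1 (by simp)
    rw [mul_one, show d - 1 + 1 = d by omega, hgf] at h2
    rcases hirr.isUnit_or_isUnit h2 with h | h
    · exact homog_not_unit _ _ (by omega) (isHomogeneous_homogenize g) h
    · exact homog_not_unit _ _ le_rfl (isHomogeneous_homogenize 1) h
  refine ⟨g, ?_, hgd2, hgf⟩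
  have hg0 : g ≠ 0 := by
    intro h
    rw [h, natDegree_zero] at hgd2
    omega
  refine ⟨fun h => ?_, fun u v huv => ?_⟩
  · have := natDegree_eq_zero_of_isUnit h
    omega
  · have hu0 : u ≠ 0 := by rintro rfl; simp at huv; exact hg0 huv
    have hv0 : v ≠ 0 := by rintro rfl; simp at huv; exact hg0 huv
    have h2 := homogenize_mul u v (le_refl u.natDegree) (le_refl v.natDegree)
    rw [← huv, ← natDegree_mul hu0 hv0, ← huv, hgd2, hgf] at h2
    rcases hirr.isUnit_or_isUnit h2 with h | h
    · left
      have : u.natDegree = 0 := by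
        by_contra hne
        exact homog_not_unit _ _ (Nat.one_le_iff_ne_zero.2 hne) (isHomogeneous_homogenize u) h
      rw [eq_C_of_natDegree_eq_zero this] at hu0 ⊢
      exact isUnit_C.2 (isUnit_iff_ne_zero.2 (by simpa using hu0))
    · right
      have : v.natDegree = 0 := by
        by_contra hne
        exact homog_not_unit _ _ (Nat.one_le_iff_ne_zero.2 hne) (isHomogeneous_homogenize v) h
      rw [eq_C_of_natDegree_eq_zero this] at hv0 ⊢
      exact isUnit_C.2 (isUnit_iff_ne_zero.2 (by simpa using hv0))

/-- evaluation of the homogenization -/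
theorem eval_form (g : ℚ[X]) (d : ℕ) (x y : ℚ) : MvPolynomial.eval ![x, y] (g.homogenize d) =
    ∑ i ∈ Finset.range (d + 1), g.coeff i * x ^ i * y ^ (d - i) := by
  rw [Polynomial.homogenize, map_sum, Finset.Nat.sum_antidiagonal_eq_sum_range_succ_mk]
  refine Finset.sum_congr rfl fun i _ => ?_
  rw [MvPolynomial.eval_monomial, Finsupp.prod_fintype _ _ (by simp), Fin.prod_univ_two]
  simp [mul_assoc]

/-- integer clearing -/
theorem int_form (g : ℚ[X]) (d : ℕ) (hgd : g.natDegree = d) (hd : 2 ≤ d) :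
    ∃ (D : ℤ) (G : ℤ[X]), D ≠ 0 ∧ G.map (Int.castRingHom ℚ) = C (D : ℚ) * g ∧ G.natDegree = d := by
  obtain ⟨D, hD, hDG⟩ := IsLocalization.integerNormalization_spec (nonZeroDivisors ℤ) g
  have hD0 : D ≠ 0 := nonZeroDivisors.ne_zero hD
  have hDQ : (D : ℚ) ≠ 0 := by exact_mod_cast hD0
  have h2 : (IsLocalization.integerNormalization (nonZeroDivisors ℤ) g).map (Int.castRingHom ℚ) =
      C (D : ℚ) * g := by
    rw [← eq_intCast (algebraMap ℤ ℚ), ← smul_eq_C_mul, algebraMap_smul]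
    exact hDG
  refine ⟨D, IsLocalization.integerNormalization (nonZeroDivisors ℤ) g, hD0, h2, ?_⟩
  rw [← natDegree_map_eq_of_injective (RingHom.injective_int (Int.castRingHom ℚ)), h2,
    natDegree_C_mul hDQ, hgd]

def intF (G : ℤ[X]) (d : ℕ) (x y : ℤ) : ℤ :=
  ∑ i ∈ Finset.range (d + 1), G.coeff i * x ^ i * y ^ (d - i)

theorem intF_cast (g : ℚ[X]) (d : ℕ) (D : ℤ) (G : ℤ[X])
    (hG : G.map (Int.castRingHom ℚ) = C (D : ℚ) * g) (x y : ℤ) :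
    (intF G d x y : ℚ) = D * MvPolynomial.eval ![(x : ℚ), (y : ℚ)] (g.homogenize d) := by
  rw [eval_form, intF, Finset.mul_sum]
  push_cast
  refine Finset.sum_congr rfl fun i _ => ?_
  have : (G.coeff i : ℚ) = D * g.coeff i := by
    have := congrArg (fun q => q.coeff i) hG
    simpa using this
  rw [this]
  ring

theorem intF_dvd (G : ℤ[X]) (d : ℕ) (x y p : ℤ) (hx : p ∣ x) (hy : p ∣ y) : p ^ d ∣ intF G d x y := by
  refine Finset.dvd_sum fun i hi => ?_
  rw [Finset.mem_range] at hi
  have : p ^ d = p ^ i * p ^ (d - i) := by rw [← pow_add]; congr 1; omega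
  rw [this, mul_assoc]
  exact Dvd.dvd.mul_left (mul_dvd_mul (pow_dvd_pow_of_dvd hx i) (pow_dvd_pow_of_dvd hy _)) _

theorem intF_y_dvd (G : ℤ[X]) (d : ℕ) (x y p : ℤ) (hp : Prime p) (hG : ¬ p ∣ G.coeff d) (hy : p ∣ y)
    (hF : p ∣ intF G d x y) : p ∣ x := by
  rw [intF, Finset.sum_range_succ] at hF
  have h1 : p ∣ ∑ i ∈ Finset.range d, G.coeff i * x ^ i * y ^ (d - i) := by
    refine Finset.dvd_sum fun i hi => ?_
    rw [Finset.mem_range] at hi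
    exact Dvd.dvd.mul_left (dvd_pow hy (by omega)) _
  have h2 := (dvd_add_right h1).1 hF
  rw [Nat.sub_self, pow_zero, mul_one] at h2
  exact hp.dvd_of_dvd_pow ((hp.dvd_or_dvd h2).resolve_left hG)

theorem intF_root (G : ℤ[X]) (d : ℕ) (hGd : G.natDegree = d) (x y p : ℤ) (hp : Prime p) (hy : ¬ p ∣ y)
    (hF : p ∣ intF G d x y) : ∃ z : ℤ, p ∣ G.eval z := by
  have hcop : IsCoprime p y := (hp.irreducible.coprime_iff_not_dvd).2 hy
  obtain ⟨u, v, huv⟩ := hcop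
  refine ⟨v * x, ?_⟩
  have hmod : y * (v * x) ≡ x [ZMOD p] := by
    refine (Int.modEq_iff_dvd.2 ⟨u * x, ?_⟩)
    linear_combination (-x) * huv
  have h1 : intF G d (y * (v * x)) y = y ^ d * G.eval (v * x) := by
    rw [eval_eq_sum_range, hGd, intF, Finset.mul_sum]
    refine Finset.sum_congr rfl fun i hi => ?_
    rw [Finset.mem_range] at hi
    have : y ^ d = y ^ i * y ^ (d - i) := by rw [← pow_add]; congr 1; omega
    rw [this]; ring
  have h2 : intF G d (y * (v * x)) y ≡ intF G d x y [ZMOD p] := by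
    unfold intF
    refine Int.ModEq.sum fun i _ => ?_
    exact ((hmod.pow i).mul_left _).mul_right _
  have h3 : p ∣ y ^ d * G.eval (v * x) := by
    rw [← h1]
    exact (Int.ModEq.dvd_iff h2).2 hF
  exact (hp.dvd_or_dvd h3).resolve_left fun h => hy (hp.dvd_of_dvd_pow h)

end P11

section P12
open Polynomial
open scoped NumberField

theorem quot_int (K : Type) [Field K] [NumberField K] (I : Ideal (𝓞 K)) (p : ℕ) (hp : p.Prime)
    (hI : Ideal.absNorm I = p) (x : 𝓞 K) : ∃ a : ℤ, x - a ∈ I := by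
  have : Fact p.Prime := ⟨hp⟩
  have hcard : Nat.card (𝓞 K ⧸ I) = p := by rw [← hI, Ideal.absNorm_apply, Submodule.cardQuot_apply]
  have h1 : (1 : 𝓞 K ⧸ I) ≠ 0 := by
    intro h
    have hsub : Subsingleton (𝓞 K ⧸ I) := subsingleton_of_zero_eq_one h.symm
    rw [Nat.card_of_subsingleton (0 : 𝓞 K ⧸ I)] at hcard
    exact hp.one_lt.ne hcard
  have h2 := mem_zmultiples_of_prime_card (g := (1 : 𝓞 K ⧸ I)) (g' := Ideal.Quotient.mk I x) hcard h1
  obtain ⟨a, ha⟩ := AddSubgroup.mem_zmultiples_iff.1 h2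
  refine ⟨a, ?_⟩
  rw [← Ideal.Quotient.eq, ← ha]
  simp

theorem idealCount_ge_two (K : Type) [Field K] [NumberField K] (p : ℕ) (hp : p.Prime)
    (I J : Ideal (𝓞 K)) (hI : Ideal.absNorm I = p) (hJ : Ideal.absNorm J = p) (hIJ : I ≠ J) :
    2 ≤ idealCount K p := by
  unfold idealCount
  have : Finite {I : Ideal (𝓞 K) // Ideal.absNorm I = p} :=
    (Ideal.finite_setOfPred_absNorm_eq p).to_subtype
  rw [← Nat.lt_iff_add_one_le, Finite.one_lt_card_iff_nontrivial]
  exact ⟨⟨⟨I, hI⟩, ⟨J, hJ⟩, fun h => hIJ (congrArg Subtype.val h)⟩⟩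

theorem idealCount_pos (K : Type) [Field K] [NumberField K] (p : ℕ) (hp : p.Prime)
    (I : Ideal (𝓞 K)) (hI : Ideal.absNorm I = p) : idealCount K p ≠ 0 := by
  unfold idealCount
  have : Finite {I : Ideal (𝓞 K) // Ideal.absNorm I = p} :=
    (Ideal.finite_setOfPred_absNorm_eq p).to_subtype
  have : Nonempty {I : Ideal (𝓞 K) // Ideal.absNorm I = p} := ⟨⟨I, hI⟩⟩
  exact Nat.card_pos.ne'

theorem exists_of_idealCount (K : Type) [Field K] [NumberField K] (p : ℕ)
    (h : 1 ≤ idealCount K p) : ∃ I : Ideal (𝓞 K), Ideal.absNorm I = p := by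
  by_contra hcon
  push Not at hcon
  have : IsEmpty {I : Ideal (𝓞 K) // Ideal.absNorm I = p} := ⟨fun I => hcon I.1 I.2⟩
  unfold idealCount at h
  simp at h

/-- ideals with integer representatives containing p -/
theorem absNorm_of_int (K : Type) [Field K] [NumberField K] (p : ℕ) (hp : p.Prime)
    (I : Ideal (𝓞 K)) (hI : I ≠ ⊤) (hpI : (p : 𝓞 K) ∈ I) (h : ∀ x : 𝓞 K, ∃ a : ℤ, x - a ∈ I) :
    Ideal.absNorm I = p := by
  have : Fact p.Prime := ⟨hp⟩
  have hch : ((p : ℕ) : 𝓞 K ⧸ I) = 0 := by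
    rw [← map_natCast (Ideal.Quotient.mk I)]
    exact Ideal.Quotient.eq_zero_iff_mem.2 hpI
  have hnt : Nontrivial (𝓞 K ⧸ I) := Ideal.Quotient.nontrivial_iff.2 hI
  have : CharP (𝓞 K ⧸ I) p := (CharP.charP_iff_prime_eq_zero hp).2 hch
  let φ : ZMod p →+* 𝓞 K ⧸ I := ZMod.castHom (dvd_refl p) _
  have hinj : Function.Injective φ := φ.injective
  have hsurj : Function.Surjective φ := by
    intro q
    obtain ⟨x, rfl⟩ := Ideal.Quotient.mk_surjective q
    obtain ⟨a, ha⟩ := h x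
    refine ⟨(a : ZMod p), ?_⟩
    rw [map_intCast, ← map_intCast (Ideal.Quotient.mk I)]
    exact ((Ideal.Quotient.eq).2 ha).symm
  rw [Ideal.absNorm_apply, Submodule.cardQuot_apply,
    ← Nat.card_congr (Equiv.ofBijective φ ⟨hinj, hsurj⟩), Nat.card_zmod]

theorem two_embeddings (K L : Type) [Field K] [NumberField K] [Field L] [NumberField L]
    (σ τ : K →+* L) (hst : σ ≠ τ) :
    ∃ p0 : ℕ, ∀ p : ℕ, p.Prime → p0 < p → 1 ≤ idealCount L p → 2 ≤ idealCount K p := by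
  let s : 𝓞 K →+* 𝓞 L := NumberField.RingOfIntegers.mapRingHom σ
  let t : 𝓞 K →+* 𝓞 L := NumberField.RingOfIntegers.mapRingHom τ
  obtain ⟨β, hβ⟩ : ∃ β : 𝓞 K, s β ≠ t β := by
    by_contra hcon
    push Not at hcon
    apply hst
    refine IsFractionRing.injective_comp_algebraMap (A := 𝓞 K) ?_
    refine RingHom.ext fun x => ?_
    exact congrArg (algebraMap (𝓞 L) L) (hcon x)
  set δ := s β - t β with hδ
  have hδ0 : δ ≠ 0 := sub_ne_zero.2 hβ
  refine ⟨Ideal.absNorm (Ideal.span {δ}), fun p hp hpp h1 => ?_⟩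
  obtain ⟨P, hP⟩ := exists_of_idealCount L p h1
  have hres : ∀ u : 𝓞 K →+* 𝓞 L, Ideal.absNorm (P.comap u) = p := by
    intro u
    refine absNorm_of_int K p hp _ ?_ ?_ ?_
    · have : P ≠ ⊤ := by
        rintro rfl
        rw [Ideal.absNorm_top] at hP
        exact hp.one_lt.ne hP
      exact Ideal.comap_ne_top _ this
    · rw [Ideal.mem_comap, map_natCast, ← hP]
      exact Ideal.absNorm_mem P
    · intro x
      obtain ⟨a, ha⟩ := quot_int L P p hp hP (u x)
      refine ⟨a, ?_⟩
      rw [Ideal.mem_comap, map_sub, map_intCast]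
      exact ha
  refine idealCount_ge_two K p hp _ _ (hres s) (hres t) fun heq => ?_
  obtain ⟨a, ha⟩ := quot_int K _ p hp (hres s) β
  have hb := ha
  rw [heq] at hb
  rw [Ideal.mem_comap, map_sub, map_intCast] at ha hb
  have hd : δ ∈ P := by
    have := P.sub_mem ha hb
    rw [hδ]
    simpa using this
  have h2 : p ∣ Ideal.absNorm (Ideal.span {δ}) := by
    rw [← hP]
    exact Ideal.absNorm_dvd_absNorm_of_le ((Ideal.span_singleton_le_iff_mem _).2 hd)
  have h3 : Ideal.absNorm (Ideal.span {δ}) ≠ 0 := by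
    rw [Ne, Ideal.absNorm_eq_zero_iff]
    simpa using hδ0
  exact absurd (Nat.le_of_dvd (Nat.pos_of_ne_zero h3) h2) (by omega)
end P12

section P13
open Polynomial
open scoped NumberField

theorem norm_sub_gen (K : Type) [Field K] [NumberField K] (B : PowerBasis ℚ K) (z : ℚ) :
    Algebra.norm ℚ (algebraMap ℚ K z - B.gen) = (minpoly ℚ B.gen).eval z := by
  rw [Algebra.norm_eq_matrix_det B.basis, map_sub, AlgHom.commutes, ← charpoly_leftMulMatrix,
    Matrix.eval_charpoly]
  rfl

theorem span_ne_top (K : Type) [Field K] [NumberField K] (p : ℕ) (hp : p.Prime) (w : 𝓞 K)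
    (h : (p : ℤ) ∣ Algebra.norm ℤ w) : Ideal.span {(p : 𝓞 K), w} ≠ ⊤ := by
  intro htop
  have h1 := (Ideal.eq_top_iff_one _).1 htop
  obtain ⟨c, e, hce⟩ := Ideal.mem_span_pair.1 h1
  by_cases hw : w = 0
  · rw [hw, mul_zero, add_zero] at hce
    have h2 : Ideal.span {(p : 𝓞 K)} = ⊤ := by
      rw [Ideal.eq_top_iff_one, Ideal.mem_span_singleton]
      exact ⟨c, by rw [mul_comm]; exact hce.symm⟩
    have h3 := norm_span_nat K p
    rw [h2, Ideal.absNorm_top] at h3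
    have h4 : 0 < Module.finrank ℚ K := Module.finrank_pos
    have h5 := Nat.one_lt_pow h4.ne' hp.one_lt
    omega
  · have : Fact p.Prime := ⟨hp⟩
    have hne : Ideal.span {w} ≠ ⊥ := by simpa using hw
    have hfin : Finite (𝓞 K ⧸ Ideal.span {w}) := Ideal.finiteQuotientOfFreeOfNeBot _ hne
    have := Fintype.ofFinite (𝓞 K ⧸ Ideal.span {w})
    have hdvd : p ∣ Fintype.card (𝓞 K ⧸ Ideal.span {w}) := by
      rw [← Nat.card_eq_fintype_card, ← Submodule.cardQuot_apply, ← Ideal.absNorm_apply,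
        Ideal.absNorm_span_singleton]
      exact Int.natCast_dvd.1 h
    obtain ⟨q, hq⟩ := exists_prime_addOrderOf_dvd_card p hdvd
    obtain ⟨x, rfl⟩ := Ideal.Quotient.mk_surjective q
    have hpx : p • Ideal.Quotient.mk (Ideal.span {w}) x = 0 := by
      rw [← hq]; exact addOrderOf_nsmul_eq_zero _
    have hx : (p : 𝓞 K) * x ∈ Ideal.span {w} := by
      rw [← Ideal.Quotient.eq_zero_iff_mem, map_mul, map_natCast, ← nsmul_eq_mul]
      exact hpx
    have hx2 : x ∈ Ideal.span {w} := by
      have : x = c * (p * x) + (e * x) * w := by linear_combination (-x) * hce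
      rw [this]
      exact Ideal.add_mem _ (Ideal.mul_mem_left _ _ hx)
        (Ideal.mul_mem_left _ _ (Ideal.mem_span_singleton_self w))
    rw [Ideal.Quotient.eq_zero_iff_mem.2 hx2, addOrderOf_zero] at hq
    exact hp.one_lt.ne hq

theorem root_gives_ideal (K : Type) [Field K] [NumberField K] (B : PowerBasis ℚ K) (g : ℚ[X]) (D : ℤ)
    (hD : D ≠ 0) (G : ℤ[X]) (hG : G.map (Int.castRingHom ℚ) = C (D : ℚ) * g) (hg0 : g ≠ 0)
    (hmin : minpoly ℚ B.gen = g * C g.leadingCoeff⁻¹) :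
    ∃ p1 : ℕ, ∀ p : ℕ, p.Prime → p1 < p → ∀ z : ℤ, (p : ℤ) ∣ G.eval z → idealCount K p ≠ 0 := by
  have hDQ : (D : ℚ) ≠ 0 := by exact_mod_cast hD
  obtain ⟨a, ha0, ha⟩ : ∃ a : ℤ, a ≠ 0 ∧ IsIntegral ℤ (a • B.gen) := by
    have h1 : IsAlgebraic ℚ B.gen := Algebra.IsAlgebraic.isAlgebraic _
    have h2 : IsAlgebraic ℤ B.gen := (IsFractionRing.isAlgebraic_iff ℤ ℚ K).2 h1
    obtain ⟨a, ha, ha'⟩ := h2.exists_integral_multiple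
    exact ⟨a, ha, ha'⟩
  have haK : (a : K) ≠ 0 := by exact_mod_cast ha0
  have haQ : (a : ℚ) ≠ 0 := by exact_mod_cast ha0
  have hadj : Algebra.adjoin ℚ {a • B.gen} = ⊤ := by
    rw [eq_top_iff, ← B.adjoin_gen_eq_top, Algebra.adjoin_le_iff, Set.singleton_subset_iff]
    have h1 : a • B.gen ∈ Algebra.adjoin ℚ {a • B.gen} := Algebra.subset_adjoin rfl
    have h2 := Subalgebra.smul_mem _ h1 ((a : ℚ)⁻¹)
    have h3 : ((a : ℚ)⁻¹) • (a • B.gen) = B.gen := by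
      rw [← Int.cast_smul_eq_zsmul ℚ, smul_smul, inv_mul_cancel₀ haQ, one_smul]
    rw [h3] at h2
    exact h2
  set β : 𝓞 K := ⟨a • B.gen, ha⟩ with hβ
  have hβK : (algebraMap (𝓞 K) K β) = a • B.gen := rfl
  have haI : IsIntegral ℚ (a • B.gen) := ha.tower_top
  set B2 := PowerBasis.ofAdjoinEqTop haI hadj with hB2
  have hgen : B2.gen = a • B.gen := PowerBasis.ofAdjoinEqTop_gen haI hadj
  have hIntg : IsIntegral ℤ B2.gen := by rw [hgen]; exact ha
  obtain ⟨Δ, hΔ⟩ : ∃ Δ : ℤ, (Δ : ℚ) = Algebra.discr ℚ B2.basis := by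
    have h1 : IsIntegral ℤ (Algebra.discr ℚ B2.basis) := by
      refine Algebra.discr_isIntegral _ fun i => ?_
      rw [B2.basis_eq_pow]
      exact hIntg.pow _
    obtain ⟨Δ, hΔ⟩ := IsIntegrallyClosed.isIntegral_iff.1 h1
    exact ⟨Δ, by simpa using hΔ⟩
  have hΔ0 : Δ ≠ 0 := by
    rintro rfl
    exact Algebra.discr_not_zero_of_basis ℚ B2.basis (by rw [← hΔ]; simp)
  have hGlc : (G.leadingCoeff : ℚ) = D * g.leadingCoeff := by
    have h1 : (G.map (Int.castRingHom ℚ)).leadingCoeff = D * g.leadingCoeff := by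
      rw [hG, leadingCoeff_mul, leadingCoeff_C]
    rw [leadingCoeff_map_of_injective (RingHom.injective_int (Int.castRingHom ℚ))] at h1
    simpa using h1
  have hglc0 : g.leadingCoeff ≠ 0 := leadingCoeff_ne_zero.2 hg0
  have hGlc0 : G.leadingCoeff ≠ 0 := by
    have : (G.leadingCoeff : ℚ) ≠ 0 := by rw [hGlc]; exact mul_ne_zero hDQ hglc0
    exact_mod_cast this
  refine ⟨Δ.natAbs + G.leadingCoeff.natAbs, fun p hp hpp z hz => ?_⟩
  have hpZ : Prime (p : ℤ) := Nat.prime_iff_prime_int.1 hp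
  have hpΔ : ¬ (p : ℤ) ∣ Δ := fun h => by
    have := Nat.le_of_dvd (Int.natAbs_pos.2 hΔ0) (Int.natCast_dvd.1 h)
    omega
  have hpG : ¬ (p : ℤ) ∣ G.leadingCoeff := fun h => by
    have := Nat.le_of_dvd (Int.natAbs_pos.2 hGlc0) (Int.natCast_dvd.1 h)
    omega
  set w : 𝓞 K := ((a * z : ℤ) : 𝓞 K) - β with hw
  have hwK : (algebraMap (𝓞 K) K w) = algebraMap ℚ K a * (algebraMap ℚ K z - B.gen) := by
    rw [hw, map_sub, hβK, map_intCast, zsmul_eq_mul]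
    simp only [map_intCast]
    push_cast
    ring
  have hnorm : Algebra.norm ℤ w * G.leadingCoeff = a ^ (Module.finrank ℚ K) * G.eval z := by
    have h1 : ((Algebra.norm ℤ w : ℤ) : ℚ) = a ^ (Module.finrank ℚ K) * (g.eval (z:ℚ) * g.leadingCoeff⁻¹) := by
      rw [Algebra.coe_norm_int, show (w : K) = _ from hwK, map_mul, Algebra.norm_algebraMap, norm_sub_gen, hmin, eval_mul, eval_C]
    have h2 : ((G.eval z : ℤ) : ℚ) = D * g.eval (z:ℚ) := by
      have := congrArg (fun q => q.eval (z : ℚ)) hG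
      simp only [eval_mul, eval_C] at this
      rw [← this, ← eq_intCast (Int.castRingHom ℚ) z, eval_map_apply]
      simp
    have h3 : ((Algebra.norm ℤ w * G.leadingCoeff : ℤ) : ℚ) =
        ((a ^ (Module.finrank ℚ K) * G.eval z : ℤ) : ℚ) := by
      push_cast
      rw [h1, h2, hGlc]
      field_simp
    exact_mod_cast h3
  have hpn : (p : ℤ) ∣ Algebra.norm ℤ w := by
    have h1 : (p : ℤ) ∣ Algebra.norm ℤ w * G.leadingCoeff := by
      rw [hnorm]; exact Dvd.dvd.mul_left hz _
    exact (hpZ.dvd_or_dvd h1).resolve_right hpG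
  set I : Ideal (𝓞 K) := Ideal.span {(p : 𝓞 K), w} with hI
  have hpI : (p : 𝓞 K) ∈ I := Ideal.subset_span (by simp)
  have hwI : w ∈ I := Ideal.subset_span (by simp)
  refine idealCount_pos K p hp I (absNorm_of_int K p hp I (span_ne_top K p hp w hpn) hpI fun x => ?_)
  obtain ⟨u, v, huv⟩ : IsCoprime (p : ℤ) Δ := (hpZ.irreducible.coprime_iff_not_dvd).2 hpΔ
  have h1 := Algebra.discr_mul_isIntegral_mem_adjoin ℚ hIntg (NumberField.RingOfIntegers.isIntegral_coe x)
  rw [← hΔ, hgen, Algebra.adjoin_singleton_eq_range_aeval] at h1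
  obtain ⟨h, hh⟩ := h1
  have hh2 : aeval β h = (Δ : 𝓞 K) * x := by
    apply NumberField.RingOfIntegers.coe_injective
    have e1 : algebraMap (𝓞 K) K (aeval β h) = aeval (a • B.gen) h := by
      rw [← hβK, aeval_algebraMap_apply]
    rw [e1]
    refine hh.trans ?_
    rw [Int.cast_smul_eq_zsmul, zsmul_eq_mul, map_mul, map_intCast]
  have hdvd : w ∣ aeval ((a * z : ℤ) : 𝓞 K) h - aeval β h := by
    rw [hw, aeval_def, aeval_def, eval₂_eq_eval_map, eval₂_eq_eval_map]
    exact sub_dvd_eval_sub _ _ _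
  have hmem : aeval ((a * z : ℤ) : 𝓞 K) h - aeval β h ∈ I := I.mem_of_dvd hdvd hwI
  have hcast : aeval ((a * z : ℤ) : 𝓞 K) h = ((h.eval (a * z) : ℤ) : 𝓞 K) := by
    rw [← eq_intCast (algebraMap ℤ (𝓞 K)) (a * z), aeval_algebraMap_apply]
    simp
  rw [hcast, hh2] at hmem
  refine ⟨v * h.eval (a * z), ?_⟩
  have huv2 : (u : 𝓞 K) * p + v * Δ = 1 := by
    have := congrArg (Int.cast : ℤ → 𝓞 K) huv
    push_cast at this
    exact this
  have : x - ((v * h.eval (a * z) : ℤ) : 𝓞 K) =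
      (u * x) * p + (-v) * (((h.eval (a * z) : ℤ) : 𝓞 K) - Δ * x) := by
    push_cast
    linear_combination (-x) * huv2
  rw [this]
  exact I.add_mem (I.mul_mem_left _ hpI) (I.mul_mem_left _ hmem)
end P13

section P14
open Polynomial
open scoped NumberField

theorem good_primes (g : ℚ[X]) (hg : Irreducible g) (d : ℕ) (hgd : g.natDegree = d) (hd : 2 ≤ d)
    (D : ℤ) (hD : D ≠ 0) (G : ℤ[X]) (hG : G.map (Int.castRingHom ℚ) = C (D : ℚ) * g)
    (hGd : G.natDegree = d) (M : ℕ) :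
    ∃ X : ℝ, ∀ x : ℝ, X ≤ x → ∃ p : ℕ, p.Prime ∧ M < p ∧ x / 3 < p ∧ p < x / 2 ∧
      ∀ u v : ℤ, (p : ℤ) ∣ intF G d u v → (p : ℤ) ∣ u ∧ (p : ℤ) ∣ v := by
  have hfact : Fact (Irreducible g) := ⟨hg⟩
  have hg0 : g ≠ 0 := hg.ne_zero
  let B := AdjoinRoot.powerBasis hg0
  have : FiniteDimensional ℚ (AdjoinRoot g) := B.finite
  have : CharZero (AdjoinRoot g) := charZero_of_injective_algebraMap (algebraMap ℚ (AdjoinRoot g)).injective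
  have hNF : NumberField (AdjoinRoot g) := ⟨⟩
  have : CharZero (SplittingField g) :=
    charZero_of_injective_algebraMap (algebraMap ℚ (SplittingField g)).injective
  have hNF2 : NumberField (SplittingField g) := ⟨⟩
  have hmin : minpoly ℚ B.gen = g * C g.leadingCoeff⁻¹ := AdjoinRoot.minpoly_powerBasis_gen hg0
  have hcard : Nat.card (AdjoinRoot g →ₐ[ℚ] SplittingField g) = B.dim := by
    refine AlgHom.natCard_of_powerBasis B (Algebra.IsSeparable.isSeparable ℚ B.gen) ?_
    have hmin2 := AdjoinRoot.minpoly_powerBasis_gen hg0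
    refine Eq.mpr (congrArg (fun q => (map (algebraMap ℚ g.SplittingField) q).Splits) hmin2) ?_
    rw [Polynomial.map_mul]
    refine (SplittingField.splits g).mul ?_
    rw [Polynomial.map_C]
    exact Splits.C _
  have hdim : B.dim = d := by rw [← hgd]; exact AdjoinRoot.powerBasis_dim hg0
  obtain ⟨σ, τ, hst⟩ : ∃ σ τ : AdjoinRoot g →ₐ[ℚ] SplittingField g, σ ≠ τ := by
    have hnt : Nontrivial (AdjoinRoot g →ₐ[ℚ] SplittingField g) :=
      Finite.one_lt_card_iff_nontrivial.1 (by omega)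
    exact hnt.exists_pair_ne
  have hyp := two_embeddings (AdjoinRoot g) (SplittingField g) (σ : AdjoinRoot g →+* SplittingField g)
    (τ : AdjoinRoot g →+* SplittingField g) (fun h => hst (AlgHom.coe_ringHom_injective h))
  obtain ⟨X, hX⟩ := window (AdjoinRoot g) (SplittingField g) hyp
  obtain ⟨p1, hp1⟩ := root_gives_ideal (AdjoinRoot g) B g D hD G hG hg0 hmin
  have hGlc0 : G.coeff d ≠ 0 := by
    rw [← hGd, coeff_natDegree, leadingCoeff_ne_zero]
    rintro rfl
    rw [natDegree_zero] at hGd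
    omega
  set T : ℕ := M + p1 + (G.coeff d).natAbs with hT
  refine ⟨max X (3 * T), fun x hx => ?_⟩
  obtain ⟨p, hp, h3, h2, h0⟩ := hX x (le_trans (le_max_left _ _) hx)
  have hpT : T < p := by
    have := le_trans (le_max_right _ _) hx
    have h4 : (T : ℝ) < p := by linarith
    exact_mod_cast h4
  have hpZ : Prime (p : ℤ) := Nat.prime_iff_prime_int.1 hp
  refine ⟨p, hp, by omega, h3, h2, fun u v huv => ?_⟩
  have hpG : ¬ (p : ℤ) ∣ G.coeff d := fun h => by
    have := Nat.le_of_dvd (Int.natAbs_pos.2 hGlc0) (Int.natCast_dvd.1 h)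
    omega
  by_cases hv : (p : ℤ) ∣ v
  · exact ⟨intF_y_dvd G d u v p hpZ hpG hv huv, hv⟩
  · obtain ⟨z, hz⟩ := intF_root G d hGd u v p hpZ hv huv
    exact absurd h0 (hp1 p hp (by omega) z hz)

theorem dvd_df_odd (p : ℕ) (hp : 1 ≤ p) (k : ℕ) : p ∣ (p + 2 * k).doubleFactorial := by
  induction k with
  | zero =>
    obtain _ | _ | q := p
    · omega
    · simp
    · rw [mul_zero, add_zero, Nat.doubleFactorial_add_two]
      exact Dvd.intro _ rfl
  | succ k ih =>
    rw [show p + 2 * (k + 1) = p + 2 * k + 2 by ring, Nat.doubleFactorial_add_two]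
    exact Dvd.dvd.mul_left ih _

theorem dvd_df (p n : ℕ) (hp : p.Prime) (hp2 : 3 ≤ p) (h : 2 * p ≤ n) : p ∣ n.doubleFactorial := by
  have hodd : p % 2 = 1 := hp.eq_two_or_odd.resolve_left (by omega)
  rcases Nat.even_or_odd' n with ⟨k, hk | hk⟩
  · rw [hk, Nat.doubleFactorial_two_mul]
    exact Dvd.dvd.mul_left ((hp.dvd_factorial).2 (by omega)) _
  · have := dvd_df_odd p hp.one_le ((n - p) / 2)
    rwa [show p + 2 * ((n - p) / 2) = n by omega] at this

theorem sq_not_dvd_df (p : ℕ) (hp : p.Prime) (hp2 : 3 ≤ p) (m : ℕ) : m < 3 * p →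
    (¬ p ^ 2 ∣ m.doubleFactorial) ∧ (m < p → ¬ p ∣ m.doubleFactorial) ∧
      (m % 2 = 0 → m < 2 * p → ¬ p ∣ m.doubleFactorial) := by
  have hodd : p % 2 = 1 := hp.eq_two_or_odd.resolve_left (by omega)
  induction m using Nat.twoStepInduction with
  | zero =>
    intro _
    have : ¬ p ^ 2 = 1 := by nlinarith
    simp [hp.ne_one, this]
  | one =>
    intro _
    have : ¬ p ^ 2 = 1 := by nlinarith
    simp [hp.ne_one, this]
  | more m ih _ =>
    intro hm
    obtain ⟨i1, i2, i3⟩ := ih (by omega)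
    rw [Nat.doubleFactorial_add_two]
    refine ⟨fun hd => ?_, fun h hd => ?_, fun he h hd => ?_⟩
    · by_cases hpm : p ∣ m + 2
      · obtain ⟨c, hc⟩ := hpm
        have hc3 : c < 3 := by
          rw [hc, mul_comm] at hm
          exact Nat.lt_of_mul_lt_mul_right hm
        have hc0 : c ≠ 0 := by rintro rfl; omega
        have h1 : ¬ p ∣ m.doubleFactorial := by
          have : c = 1 ∨ c = 2 := by omega
          rcases this with rfl | rfl
          · exact i2 (by omega)
          · exact i3 (by omega) (by omega)
        rw [hc, pow_two, mul_assoc] at hd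
        have h2 := Nat.dvd_of_mul_dvd_mul_left hp.pos hd
        rcases (hp.dvd_mul).1 h2 with h3 | h3
        · have := Nat.le_of_dvd (by omega) h3
          omega
        · exact h1 h3
      · have hcop : Nat.Coprime (p ^ 2) (m + 2) := Nat.Coprime.pow_left 2 ((hp.coprime_iff_not_dvd).2 hpm)
        exact i1 (hcop.dvd_of_dvd_mul_left hd)
    · rcases (hp.dvd_mul).1 hd with h3 | h3
      · have := Nat.le_of_dvd (by omega) h3
        omega
      · exact i2 (by omega) h3
    · rcases (hp.dvd_mul).1 hd with h3 | h3
      · obtain ⟨c, hc⟩ := h3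
        have hc3 : c < 2 := by
          rw [hc, mul_comm] at h
          exact Nat.lt_of_mul_lt_mul_right h
        have : c = 0 ∨ c = 1 := by omega
        rcases this with rfl | rfl <;> omega
      · exact i3 (by omega) (by omega) h3

theorem prod_not_dvd (p : ℕ) (hp : p.Prime) (r d : ℕ) (hrd : r < d) (a : Fin r → ℕ)
    (h0 : ∀ i, a i ≠ 0) (h : ∀ i, ¬ p ^ 2 ∣ a i) : ¬ p ^ d ∣ ∏ i, a i := by
  intro hd
  rw [hp.pow_dvd_iff_le_factorization (Finset.prod_ne_zero_iff.2 fun i _ => h0 i),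
    Nat.factorization_prod (fun i _ => h0 i), Finsupp.finsetSum_apply] at hd
  have h1 : ∑ i : Fin r, (a i).factorization p ≤ ∑ _i : Fin r, 1 := by
    refine Finset.sum_le_sum fun i _ => ?_
    have := h i
    rw [hp.pow_dvd_iff_le_factorization (h0 i)] at this
    omega
  simp at h1
  omega
end P14

/-- Let `r ≥ 1` and let `f(x,y) ∈ ℚ[x,y]` be an irreducible
homogeneous polynomial of degree `d` with `d > r` and `d ≥ 2`, and let `b` be a
nonzero integer. Then the set of tuples `(n₁, …, n_r)` of natural numbers such
that `b·n₁‼ ⋯ n_r‼` is represented by `f` is finite. -/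
theorem stmt_8 (r : ℕ) (hr : 1 ≤ r) (f : MvPolynomial (Fin 2) ℚ) (d : ℕ)
    (hdr : r < d) (hd : 2 ≤ d) (hirr : Irreducible f) (hhom : f.IsHomogeneous d)
    (b : ℤ) (hb : b ≠ 0) :
    {n : Fin r → ℕ | ∃ x y : ℤ,
      MvPolynomial.eval ![(x : ℚ), (y : ℚ)] f
        = (b : ℚ) * ∏ i, (Nat.doubleFactorial (n i) : ℚ)}.Finite := by
  obtain ⟨g, hg, hgd, hgf⟩ := form_poly f d hd hirr hhom
  obtain ⟨D, G, hD, hG, hGd⟩ := int_form g d hgd hd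
  obtain ⟨X, hX⟩ := good_primes g hg d hgd hd D hD G hG hGd (3 + (D * b).natAbs)
  refine (Set.finite_Icc (0 : Fin r → ℕ) (fun _ => ⌈X⌉₊)).subset ?_
  rintro n ⟨x, y, hxy⟩
  refine ⟨fun _ => Nat.zero_le _, ?_⟩
  by_contra hcon
  obtain ⟨i0, hi0⟩ : ∃ i, ⌈X⌉₊ < n i := by
    rw [Pi.le_def] at hcon
    push Not at hcon
    exact hcon
  have : Nonempty (Fin r) := ⟨i0⟩
  obtain ⟨j, hj⟩ := Finite.exists_max n
  have hXj : X ≤ (n j : ℝ) := by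
    have h1 := Nat.le_ceil X
    have h2 : ((⌈X⌉₊ : ℕ) : ℝ) ≤ n j := by exact_mod_cast hi0.le.trans (hj i0)
    linarith
  obtain ⟨p, hp, hpM, h3, h2, hdiv⟩ := hX _ hXj
  have h3' : n j < 3 * p := by
    have : (n j : ℝ) < 3 * p := by linarith
    exact_mod_cast this
  have h2' : 2 * p ≤ n j := by
    have : 2 * (p : ℝ) ≤ n j := by linarith
    exact_mod_cast this
  have hF : intF G d x y = D * b * ((∏ i, (n i).doubleFactorial : ℕ) : ℤ) := by
    have h1 := intF_cast g d D G hG x y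
    rw [hgf, hxy] at h1
    have h4 : ((intF G d x y : ℤ) : ℚ) = ((D * b * ((∏ i, (n i).doubleFactorial : ℕ) : ℤ) : ℤ) : ℚ) := by
      rw [h1]; push_cast; ring
    exact_mod_cast h4
  have hpj : (p : ℤ) ∣ intF G d x y := by
    rw [hF]
    refine Dvd.dvd.mul_left (Int.natCast_dvd_natCast.2 ?_) _
    exact (dvd_df p (n j) hp (by omega) h2').trans (Finset.dvd_prod_of_mem _ (Finset.mem_univ j))
  obtain ⟨hx, hy⟩ := hdiv x y hpj
  have hpd := intF_dvd G d x y p hx hy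
  rw [hF] at hpd
  have hcop : IsCoprime ((p : ℤ) ^ d) (D * b) := by
    refine IsCoprime.pow_left (((Nat.prime_iff_prime_int.1 hp).irreducible.coprime_iff_not_dvd).2 fun h => ?_)
    have := Nat.le_of_dvd (Int.natAbs_pos.2 (mul_ne_zero hD hb)) (Int.natCast_dvd.1 h)
    omega
  have hpd2 := hcop.dvd_of_dvd_mul_left hpd
  refine prod_not_dvd p hp r d hdr (fun i => (n i).doubleFactorial) (fun i => (Nat.doubleFactorial_pos _).ne')
    (fun i => (sq_not_dvd_df p hp (by omega) (n i) (lt_of_le_of_lt (hj i) h3')).1) ?_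
  exact_mod_cast hpd2
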